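/- Identity (7.6) from the Concluding Remarks: Let x,y,n be nonnegative integers and let U, D, U', D' ⊆ [x+y+n] satisfy |U| = |U'|, |D| = |D'|, U∪D = U'∪D', U∩D = U'∩D', and let B ⊆ [x+y+n]\(U∪D) with |B| ≤ x. Then M(F_{x,y}(U;D;B)) · M(F_{x+y,0}(U';D';B)) = M(F_{x,y}(U';D';B)) · M(F_{x+y,0}(U;D;B)). In particular, both sides count pairs of lozenge tilings of the indicated halved hexagons. -/

import Mathlib

open Finset

/-- A unit triangle of the triangular lattice, in sheared coordinates:
`(true, a, j)` is the up-pointing triangle with horizontal base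
`[a + j/2, a + 1 + j/2]` on the lattice line at height `j`;
`(false, a, j)` is the down-pointing triangle with apex `(a + 1 + j/2, j)`
and top edge on the lattice line at height `j + 1`. -/
abbrev Tri : Type := Bool × ℤ × ℤ

def upT (a j : ℤ) : Tri := (true, a, j)
def dnT (a j : ℤ) : Tri := (false, a, j)

/-- A lozenge (union of two unit triangles sharing an edge), recorded by the
coordinates of its up-pointing triangle (first component) and of its
down-pointing triangle (second component). -/
abbrev Loz : Type := (ℤ × ℤ) × (ℤ × ℤ)

/-- The two triangles of a lozenge share an edge: the down-pointing triangle is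
the right, left or lower neighbour of the up-pointing one. -/
def lozAdj (l : Loz) : Prop :=
  l.2 = l.1 ∨ l.2 = (l.1.1 - 1, l.1.2) ∨ l.2 = (l.1.1, l.1.2 - 1)

/-- `T` is a lozenge tiling of the region `R`: it consists of lozenges lying in
`R` and covers every unit triangle of `R` exactly once. -/
def IsTiling (R : Finset Tri) (T : Finset Loz) : Prop :=
  (∀ l ∈ T, lozAdj l ∧ upT l.1.1 l.1.2 ∈ R ∧ dnT l.2.1 l.2.2 ∈ R) ∧
  (∀ t ∈ R, ∃! l, l ∈ T ∧ (t = upT l.1.1 l.1.2 ∨ t = dnT l.2.1 l.2.2))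

/-- All lozenge tilings of `R` avoiding the forbidden lozenges in `F`
(the barriers), collected in a finset. -/
noncomputable def tilings (R : Finset Tri) (F : Finset Loz) : Finset (Finset Loz) := by
  classical
  exact ((R.image Prod.snd ×ˢ R.image Prod.snd).powerset).filter
    (fun T => IsTiling R T ∧ ∀ l ∈ T, l ∉ F)

/-- `Mtil R F` : the number of lozenge tilings of `R` avoiding the barriers `F`. -/
noncomputable def Mtil (R : Finset Tri) (F : Finset Loz) : ℕ := (tilings R F).card

/-- Weighted tiling number: each lozenge in `Wt` carries weight `1/2`, all other
lozenges weight `1`; a tiling is weighted by the product of its lozenge weights. -/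
noncomputable def Mw (R : Finset Tri) (F : Finset Loz) (Wt : Finset Loz) : ℚ :=
  ∑ T ∈ tilings R F, (1 / 2 : ℚ) ^ (T ∩ Wt).card

/-- Reflection of a unit triangle over the horizontal lattice line `l` (height `0`). -/
def reflTri (t : Tri) : Tri :=
  if t.1 then (false, t.2.1 + t.2.2, -t.2.2 - 1) else (true, t.2.1 + t.2.2 + 1, -t.2.2 - 1)

/-- Reflection of a lozenge over the horizontal lattice line `l` (height `0`). -/
def reflLoz (l : Loz) : Loz :=
  ((l.2.1 + l.2.2 + 1, -l.2.2 - 1), (l.1.1 + l.1.2, -l.1.2 - 1))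

/-- The up-pointing unit triangles removed at the positions of `U`
(1-indexed, from left to right) just above the line `l`. -/
def upDents (U : Finset ℕ) : Finset Tri := U.image (fun (i : ℕ) => upT ((i : ℤ) - 1) 0)

/-- The down-pointing unit triangles removed at the positions of `D`
(1-indexed, from left to right) just below the line `l`. -/
def dnDents (D : Finset ℕ) : Finset Tri := D.image (fun (i : ℕ) => dnT ((i : ℤ) - 1) (-1))

/-- The vertical lozenges straddling the line `l` at the barrier positions `B`:
these are forbidden in any tiling. -/
def barrierLoz (B : Finset ℕ) : Finset Loz :=
  B.image (fun (i : ℕ) => (((i : ℤ) - 1, 0), ((i : ℤ) - 1, -1)))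

/-- The upper half of a hexagon: the semihexagon (trapezoid) with base `W` on the
line `l` and `h` rows of unit triangles above it. -/
def upperHex (W h : ℕ) : Finset Tri :=
  (Finset.range h).biUnion fun j =>
    ((Finset.range (W - j)).image fun (a : ℕ) => upT (a : ℤ) (j : ℤ)) ∪
    ((Finset.range (W - j - 1)).image fun (a : ℕ) => dnT (a : ℤ) (j : ℤ))

/-- The doubly-dented hexagon `H_{x,y}(U; D)` (with `n = |U ∪ D|` recorded
explicitly): the hexagon of side lengths `x+n-u, y+u, y+d, x+n-d, y+d, y+u`
(clockwise from the north side) with the up-pointing unit triangles at the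
positions of `U` and the down-pointing unit triangles at the positions of `D`
removed along the horizontal axis `l` through its west and east vertices. -/
def Hreg (x y n : ℕ) (U D : Finset ℕ) : Finset Tri :=
  (upperHex (x + y + n) (y + U.card) \ upDents U) ∪
  ((upperHex (x + y + n) (y + D.card)).image reflTri \ dnDents D)

/-- The quartered hexagon `L_{m,n}(A)`: the trapezoid whose northern,
northeastern, southern sides have lengths `n`, `m`, `n + ⌊(m+1)/2⌋` and whose
western side is a vertical zigzag of `m` steps, with the up-pointing unit
triangles at the positions of `A` removed from the base. -/
def Lreg (m n : ℕ) (A : Finset ℕ) : Finset Tri :=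
  ((Finset.range m).biUnion fun j =>
    ((Finset.range (n + (m + 1) / 2 + j / 2 - j)).image
        fun (a : ℕ) => upT ((a : ℤ) - ((j / 2 : ℕ) : ℤ)) (j : ℤ)) ∪
    ((Finset.range (n + (m + 1) / 2 + (j + 1) / 2 - (j + 1))).image
        fun (a : ℕ) => dnT ((a : ℤ) - (((j + 1) / 2 : ℕ) : ℤ)) (j : ℤ)))
  \ upDents A

/-- The vertical lozenges sitting along (the bumps of) the western zigzag side
of the quartered hexagon `L_{m,n}`; these get weight `1/2` in `L̄_{m,n}`. -/
def westLoz (m : ℕ) : Finset Loz :=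
  ((Finset.range m).filter fun j => j % 2 = 1).image fun j =>
    ((-(((j - 1) / 2 : ℕ) : ℤ), (j : ℤ)), (-(((j - 1) / 2 : ℕ) : ℤ), (j : ℤ) - 1))

/-- The doubly-dented halved hexagon `F_{x,y}(U; D)`: north, northeast,
southeast, south sides of lengths `x+n-u, 2y+2u, 2y+2d, x+n-d`, western side a
vertical zigzag with `4y+2u+2d` steps, with up-dents `U` and down-dents `D`
along the horizontal line `l` through the east vertex. -/
def Freg (x y n : ℕ) (U D : Finset ℕ) : Finset Tri :=
  Lreg (2 * y + 2 * U.card) (x + n - U.card) U ∪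
  (Lreg (2 * y + 2 * D.card) (x + n - D.card) D).image reflTri

/-- The doubly-dented halved hexagon `F̄_{x,y}(U; D)`: side lengths
`x+n-u, 2y-1+2u, 2y-1+2d, x+n-d` and a western zigzag with `4y+2u+2d-2` steps,
with up-dents `U` and down-dents `D` along the line `l` through the east vertex. -/
def Fbar (x y n : ℕ) (U D : Finset ℕ) : Finset Tri :=
  Lreg (2 * y + 2 * U.card - 1) (x + n - U.card) U ∪
  (Lreg (2 * y + 2 * D.card - 1) (x + n - D.card) D).image reflTri

/-- The weight-`1/2` vertical lozenges on the western side of `W_{x,y}(U;D;B)`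
(where `u = |U|`, `d = |D|`). -/
def wtW (y u d : ℕ) : Finset Loz :=
  westLoz (2 * y + 2 * u) ∪ (westLoz (2 * y + 2 * d)).image reflLoz

/-- The weight-`1/2` vertical lozenges on the western side of `W̄_{x,y}(U;D;B)`. -/
def wtWbar (y u d : ℕ) : Finset Loz :=
  westLoz (2 * y + 2 * u - 1) ∪ (westLoz (2 * y + 2 * d - 1)).image reflLoz

/-- `m - S = {m - s : s ∈ S}`. -/
def mirrorSet (m : ℕ) (S : Finset ℕ) : Finset ℕ := S.image fun i => m - i

/-- The reflectively symmetric doubly-dented hexagon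
`RS_{x,y}(U;D) = H_{x,y}(U ∪ ((x+y+2n+1)-U); D ∪ ((x+y+2n+1)-D))`. -/
def RSreg (x y n : ℕ) (U D : Finset ℕ) : Finset Tri :=
  Hreg x y (2 * n) (U ∪ mirrorSet (x + y + 2 * n + 1) U)
    (D ∪ mirrorSet (x + y + 2 * n + 1) D)

/-- Reflection of a lozenge over the vertical symmetry axis of a region whose
base on the line `l` spans the horizontal interval `[0, W]`. -/
def vreflLoz (W : ℤ) (l : Loz) : Loz :=
  ((W - 1 - l.1.1 - l.1.2, l.1.2), (W - 2 - l.2.1 - l.2.2, l.2.2))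

/-- The number of lozenge tilings of `R` (avoiding the barriers `F`) invariant
under the reflection over the vertical axis of a base of width `W`. -/
noncomputable def Msym (R : Finset Tri) (F : Finset Loz) (W : ℤ) : ℕ := by
  classical
  exact ((tilings R F).filter fun T => T.image (vreflLoz W) = T).card

/-- `M_r(RS_{x,y}(U;D;B))` : the number of reflectively symmetric lozenge
tilings of the symmetric doubly-dented hexagon with barriers at
`B ∪ ((x+y+2n+1)-B)`. -/
noncomputable def Mr (x y n : ℕ) (U D B : Finset ℕ) : ℕ :=
  Msym (RSreg x y n U D)
    (barrierLoz (B ∪ mirrorSet (x + y + 2 * n + 1) B))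
    ((x : ℤ) + (y : ℤ) + 2 * (n : ℤ))

/-- The skipping hyperfactorial: `H2 (2k) = 0! 2! ⋯ (2k-2)!` and
`H2 (2k+1) = 1! 3! ⋯ (2k-1)!`. -/
def H2 (n : ℕ) : ℕ :=
  ∏ j ∈ (Finset.range n).filter (fun j => j % 2 = n % 2), Nat.factorial j

/-- `∏_{1 ≤ i < j ≤ k} (s_j² - s_i²)` for the increasing enumeration
`s_1 < ⋯ < s_k` of `S`. -/
def prodDiffSq (S : Finset ℕ) : ℚ :=
  ∏ p ∈ S, ∏ q ∈ S.filter (fun q => p < q), ((q : ℚ) ^ 2 - (p : ℚ) ^ 2)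

/-- `∏_{1 ≤ i < j ≤ k} (s_j - s_i)`. -/
def prodDiff (S : Finset ℕ) : ℚ :=
  ∏ p ∈ S, ∏ q ∈ S.filter (fun q => p < q), ((q : ℚ) - (p : ℚ))

/-- `∏_{1 ≤ i < j ≤ k} (s_j - s_i)(s_j + s_i - 1)`. -/
def prodDS1 (S : Finset ℕ) : ℚ :=
  ∏ p ∈ S, ∏ q ∈ S.filter (fun q => p < q), (((q : ℚ) - (p : ℚ)) * ((q : ℚ) + (p : ℚ) - 1))

/-- `∏_{1 ≤ i < j ≤ k} (s_j - s_i)(s_j + s_i - 2)`. -/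
def prodDS2 (S : Finset ℕ) : ℚ :=
  ∏ p ∈ S, ∏ q ∈ S.filter (fun q => p < q), (((q : ℚ) - (p : ℚ)) * ((q : ℚ) + (p : ℚ) - 2))

/-- `∏_{1 ≤ i < j ≤ k} (s_i + s_j)`. -/
def prodSum0 (S : Finset ℕ) : ℚ :=
  ∏ p ∈ S, ∏ q ∈ S.filter (fun q => p < q), ((q : ℚ) + (p : ℚ))

/-- `∏_{1 ≤ i < j ≤ k} (s_i + s_j - 1)`. -/
def prodSum1 (S : Finset ℕ) : ℚ :=
  ∏ p ∈ S, ∏ q ∈ S.filter (fun q => p < q), ((q : ℚ) + (p : ℚ) - 1)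

/-- `∏_{1 ≤ i < j ≤ k} (s_i + s_j - 2)`. -/
def prodSum2 (S : Finset ℕ) : ℚ :=
  ∏ p ∈ S, ∏ q ∈ S.filter (fun q => p < q), ((q : ℚ) + (p : ℚ) - 2)

/-- `∏_{1 ≤ i ≤ j ≤ k} (s_i + s_j - 1)` (the diagonal `i = j` included). -/
def prodSumLe1 (S : Finset ℕ) : ℚ :=
  ∏ p ∈ S, ∏ q ∈ S.filter (fun q => p ≤ q), ((q : ℚ) + (p : ℚ) - 1)

theorem isTiling_iff (R : Finset Tri) (T : Finset Loz) :
    IsTiling R T ↔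
      (∀ l ∈ T, lozAdj l ∧ upT l.1.1 l.1.2 ∈ R ∧ dnT l.2.1 l.2.2 ∈ R) ∧
      (∀ p : ℤ × ℤ, (true, p) ∈ R → ∃ l ∈ T, l.1 = p) ∧
      (∀ p : ℤ × ℤ, (false, p) ∈ R → ∃ l ∈ T, l.2 = p) ∧
      (∀ l ∈ T, ∀ l' ∈ T, l.1 = l'.1 → l = l') ∧
      (∀ l ∈ T, ∀ l' ∈ T, l.2 = l'.2 → l = l') := by
  constructor
  · rintro ⟨h1, h2⟩
    refine ⟨h1, ?_, ?_, ?_, ?_⟩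
    · intro p hp
      obtain ⟨l, ⟨hl, hc⟩, -⟩ := h2 _ hp
      refine ⟨l, hl, ?_⟩
      rcases hc with hc | hc <;> simp [upT, dnT] at hc
      exact hc.symm
    · intro p hp
      obtain ⟨l, ⟨hl, hc⟩, -⟩ := h2 _ hp
      refine ⟨l, hl, ?_⟩
      rcases hc with hc | hc <;> simp [upT, dnT] at hc
      exact hc.symm
    · intro l hl l' hl' h
      exact (h2 _ (h1 l hl).2.1).unique ⟨hl, Or.inl rfl⟩ ⟨hl', Or.inl (by rw [h])⟩
    · intro l hl l' hl' h
      exact (h2 _ (h1 l hl).2.2).unique ⟨hl, Or.inr rfl⟩ ⟨hl', Or.inr (by rw [h])⟩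
  · rintro ⟨h1, hu, hd, iu, id⟩
    refine ⟨h1, ?_⟩
    rintro ⟨_ | _, p⟩ ht
    · obtain ⟨l, hl, rfl⟩ := hd p ht
      refine ⟨l, ⟨hl, Or.inr rfl⟩, ?_⟩
      rintro l' ⟨hl', hc⟩
      rcases hc with hc | hc <;> simp [upT, dnT] at hc
      exact id _ hl' _ hl hc.symm
    · obtain ⟨l, hl, rfl⟩ := hu p ht
      refine ⟨l, ⟨hl, Or.inl rfl⟩, ?_⟩
      rintro l' ⟨hl', hc⟩
      rcases hc with hc | hc <;> simp [upT, dnT] at hc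
      exact iu _ hl' _ hl hc.symm

theorem mem_tilings (R : Finset Tri) (F T : Finset Loz) :
    T ∈ tilings R F ↔ IsTiling R T ∧ ∀ l ∈ T, l ∉ F := by
  classical
  unfold tilings
  rw [Finset.mem_filter, and_iff_right_iff_imp]
  rintro ⟨h, -⟩
  rw [Finset.mem_powerset]
  intro l hl
  obtain ⟨-, h1, h2⟩ := h.1 l hl
  exact Finset.mem_product.2
    ⟨Finset.mem_image.2 ⟨_, h1, rfl⟩, Finset.mem_image.2 ⟨_, h2, rfl⟩⟩

/-- The vertical lozenge at position `i` crossing the lattice line at height `h`. -/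
def crossLoz (h i : ℤ) : Loz := ((i, h), (i, h - 1))

/-- The up-pointing unit triangles at positions `S` on the row of height `h`. -/
def upRow (h : ℤ) (S : Finset ℤ) : Finset Tri := S.image fun i => upT i h

/-- The down-pointing unit triangles at positions `S` on the row of height `h`. -/
def dnRow (h : ℤ) (S : Finset ℤ) : Finset Tri := S.image fun i => dnT i h

theorem upT_mem_upRow {h a b : ℤ} {S : Finset ℤ} :
    ((true, a, b) : Tri) ∈ upRow h S ↔ a ∈ S ∧ b = h := by
  simp only [upRow, upT, Finset.mem_image, Prod.mk.injEq, true_and]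
  grind

theorem dnT_notMem_upRow {h : ℤ} {p : ℤ × ℤ} {S : Finset ℤ} :
    ((false, p) : Tri) ∉ upRow h S := by
  simp [upRow, upT]

theorem dnT_mem_dnRow {h a b : ℤ} {S : Finset ℤ} :
    ((false, a, b) : Tri) ∈ dnRow h S ↔ a ∈ S ∧ b = h := by
  simp only [dnRow, dnT, Finset.mem_image, Prod.mk.injEq, true_and]
  grind

theorem upT_notMem_dnRow {h : ℤ} {p : ℤ × ℤ} {S : Finset ℤ} :
    ((true, p) : Tri) ∉ dnRow h S := by
  simp [dnRow, dnT]

theorem mem_image_crossLoz {h a b c d : ℤ} {S : Finset ℤ} :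
    ((a, b), (c, d)) ∈ S.image (crossLoz h) ↔ a ∈ S ∧ b = h ∧ c = a ∧ d = h - 1 := by
  simp only [crossLoz, Finset.mem_image, Prod.mk.injEq]
  grind

section Split

variable {R₁ R₂ : Finset Tri} {F : Finset Loz} {h : ℤ} {X : Finset ℤ}

theorem isTiling_upper_of_isTiling (h₁ : ∀ t ∈ R₁, h ≤ t.2.2) (h₂ : ∀ t ∈ R₂, t.2.2 < h)
    {T : Finset Loz} (hT : IsTiling (R₁ ∪ R₂) T) (hX : ∀ i, crossLoz h i ∈ T → i ∈ X) :
    IsTiling (R₁ \ upRow h (X.filter fun i => crossLoz h i ∈ T))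
      (T.filter fun l => h ≤ l.2.2) := by
  rw [isTiling_iff] at hT ⊢
  obtain ⟨ha, hu, hd, iu, id⟩ := hT
  refine ⟨?_, ?_, ?_, ?_, ?_⟩
  · rintro ⟨⟨a, b⟩, ⟨c, d⟩⟩ hl
    rw [Finset.mem_filter] at hl
    obtain ⟨hl, hlh⟩ := hl
    have := ha _ hl
    simp only [upT, dnT, lozAdj, Finset.mem_union, Prod.mk.injEq] at this hlh ⊢
    refine ⟨this.1, ?_, ?_⟩
    · rw [Finset.mem_sdiff, upT_mem_upRow, Finset.mem_filter]
      refine ⟨?_, ?_⟩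
      · rcases this.2.1 with h' | h'
        · exact h'
        · have := h₂ _ h'
          simp only at this
          omega
      · rintro ⟨⟨-, h'⟩, rfl⟩
        have := iu _ hl _ h' rfl
        simp [crossLoz] at this
        omega
    · rw [Finset.mem_sdiff]
      refine ⟨?_, dnT_notMem_upRow⟩
      rcases this.2.2 with h' | h'
      · exact h'
      · have := h₂ _ h'
        simp only at this
        omega
  · rintro ⟨p, q⟩ hp
    rw [Finset.mem_sdiff, upT_mem_upRow, Finset.mem_filter] at hp
    obtain ⟨⟨⟨a, b⟩, ⟨c, d⟩⟩, hl, he⟩ := hu _ (Finset.mem_union_left _ hp.1)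
    refine ⟨_, Finset.mem_filter.2 ⟨hl, ?_⟩, he⟩
    simp only [Prod.mk.injEq] at he ⊢
    obtain ⟨rfl, rfl⟩ := he
    by_contra hlt
    have h3 := (ha _ hl).1
    have h4 := h₁ _ hp.1
    simp only [lozAdj, Prod.mk.injEq] at h3 h4
    have h5 : b = h ∧ c = a ∧ d = h - 1 := by omega
    obtain ⟨rfl, rfl, rfl⟩ := h5
    exact hp.2 ⟨⟨hX _ hl, hl⟩, rfl⟩
  · rintro ⟨p, q⟩ hp
    rw [Finset.mem_sdiff] at hp
    obtain ⟨⟨⟨a, b⟩, ⟨c, d⟩⟩, hl, he⟩ := hd _ (Finset.mem_union_left _ hp.1)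
    refine ⟨_, Finset.mem_filter.2 ⟨hl, ?_⟩, he⟩
    have h4 := h₁ _ hp.1
    simp only [Prod.mk.injEq] at he h4 ⊢
    omega
  · intro l hl l' hl'
    exact iu l (Finset.mem_filter.1 hl).1 l' (Finset.mem_filter.1 hl').1
  · intro l hl l' hl'
    exact id l (Finset.mem_filter.1 hl).1 l' (Finset.mem_filter.1 hl').1

theorem isTiling_lower_of_isTiling (h₁ : ∀ t ∈ R₁, h ≤ t.2.2) (h₂ : ∀ t ∈ R₂, t.2.2 < h)
    {T : Finset Loz} (hT : IsTiling (R₁ ∪ R₂) T) (hX : ∀ i, crossLoz h i ∈ T → i ∈ X) :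
    IsTiling (R₂ \ dnRow (h - 1) (X.filter fun i => crossLoz h i ∈ T))
      (T.filter fun l => l.1.2 < h) := by
  rw [isTiling_iff] at hT ⊢
  obtain ⟨ha, hu, hd, iu, id⟩ := hT
  refine ⟨?_, ?_, ?_, ?_, ?_⟩
  · rintro ⟨⟨a, b⟩, ⟨c, d⟩⟩ hl
    rw [Finset.mem_filter] at hl
    obtain ⟨hl, hlh⟩ := hl
    have := ha _ hl
    simp only [upT, dnT, lozAdj, Finset.mem_union, Prod.mk.injEq] at this hlh ⊢
    refine ⟨this.1, ?_, ?_⟩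
    · rw [Finset.mem_sdiff]
      refine ⟨?_, upT_notMem_dnRow⟩
      rcases this.2.1 with h' | h'
      · have := h₁ _ h'
        simp only at this
        omega
      · exact h'
    · rw [Finset.mem_sdiff, dnT_mem_dnRow, Finset.mem_filter]
      refine ⟨?_, ?_⟩
      · rcases this.2.2 with h' | h'
        · have := h₁ _ h'
          simp only at this
          omega
        · exact h'
      · rintro ⟨⟨-, h'⟩, rfl⟩
        have := id _ hl _ h' rfl
        simp [crossLoz] at this
        omega
  · rintro ⟨p, q⟩ hp
    rw [Finset.mem_sdiff] at hp
    obtain ⟨⟨⟨a, b⟩, ⟨c, d⟩⟩, hl, he⟩ := hu _ (Finset.mem_union_right _ hp.1)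
    refine ⟨_, Finset.mem_filter.2 ⟨hl, ?_⟩, he⟩
    have h4 := h₂ _ hp.1
    simp only [Prod.mk.injEq] at he h4 ⊢
    omega
  · rintro ⟨p, q⟩ hp
    rw [Finset.mem_sdiff, dnT_mem_dnRow, Finset.mem_filter] at hp
    obtain ⟨⟨⟨a, b⟩, ⟨c, d⟩⟩, hl, he⟩ := hd _ (Finset.mem_union_right _ hp.1)
    refine ⟨_, Finset.mem_filter.2 ⟨hl, ?_⟩, he⟩
    simp only [Prod.mk.injEq] at he ⊢
    obtain ⟨rfl, rfl⟩ := he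
    by_contra hlt
    have h3 := (ha _ hl).1
    have h4 := h₂ _ hp.1
    simp only [lozAdj, Prod.mk.injEq] at h3 h4
    have h5 : b = h ∧ a = c ∧ d = h - 1 := by omega
    obtain ⟨rfl, rfl, rfl⟩ := h5
    exact hp.2 ⟨⟨hX _ hl, hl⟩, rfl⟩
  · intro l hl l' hl'
    exact iu l (Finset.mem_filter.1 hl).1 l' (Finset.mem_filter.1 hl').1
  · intro l hl l' hl'
    exact id l (Finset.mem_filter.1 hl).1 l' (Finset.mem_filter.1 hl').1

theorem isTiling_glue (h₁ : ∀ t ∈ R₁, h ≤ t.2.2) (h₂ : ∀ t ∈ R₂, t.2.2 < h)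
    {S : Finset ℤ} (hS₁ : ∀ i ∈ S, upT i h ∈ R₁) (hS₂ : ∀ i ∈ S, dnT i (h - 1) ∈ R₂)
    {T₁ T₂ : Finset Loz} (hT₁ : IsTiling (R₁ \ upRow h S) T₁)
    (hT₂ : IsTiling (R₂ \ dnRow (h - 1) S) T₂) :
    IsTiling (R₁ ∪ R₂) (T₁ ∪ T₂ ∪ S.image (crossLoz h)) := by
  rw [isTiling_iff] at hT₁ hT₂ ⊢
  obtain ⟨ha₁, hu₁, hd₁, iu₁, id₁⟩ := hT₁
  obtain ⟨ha₂, hu₂, hd₂, iu₂, id₂⟩ := hT₂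
  simp only [upT, dnT, Finset.mem_sdiff] at *
  have hdisj : ∀ t, t ∈ R₁ → t ∈ R₂ → False := fun t h3 h4 => by
    have := h₁ t h3
    have := h₂ t h4
    omega
  have key : ∀ l ∈ T₁ ∪ T₂ ∪ S.image (crossLoz h), l ∈ T₁ ∨ l ∈ T₂ ∨ ∃ i ∈ S, crossLoz h i = l := by
    intro l hl
    simpa only [Finset.mem_union, Finset.mem_image, or_assoc] using hl
  refine ⟨?_, ?_, ?_, ?_, ?_⟩
  · intro l hl
    rcases key l hl with hl | hl | ⟨i, hi, rfl⟩
    · have := ha₁ l hl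
      exact ⟨this.1, Finset.mem_union_left _ this.2.1.1, Finset.mem_union_left _ this.2.2.1⟩
    · have := ha₂ l hl
      exact ⟨this.1, Finset.mem_union_right _ this.2.1.1, Finset.mem_union_right _ this.2.2.1⟩
    · exact ⟨Or.inr (Or.inr rfl), Finset.mem_union_left _ (hS₁ i hi),
        Finset.mem_union_right _ (hS₂ i hi)⟩
  · rintro ⟨p, q⟩ hp
    by_cases hS : p ∈ S ∧ q = h
    · exact ⟨crossLoz h p, by simp only [Finset.mem_union, Finset.mem_image]; grind, by
        simp [crossLoz, hS.2]⟩
    · rcases Finset.mem_union.1 hp with hp | hp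
      · obtain ⟨l, hl, he⟩ := hu₁ (p, q) ⟨hp, by rwa [upT_mem_upRow]⟩
        exact ⟨l, by simp only [Finset.mem_union]; tauto, he⟩
      · obtain ⟨l, hl, he⟩ := hu₂ (p, q) ⟨hp, upT_notMem_dnRow⟩
        exact ⟨l, by simp only [Finset.mem_union]; tauto, he⟩
  · rintro ⟨p, q⟩ hp
    by_cases hS : p ∈ S ∧ q = h - 1
    · exact ⟨crossLoz h p, by simp only [Finset.mem_union, Finset.mem_image]; grind, by
        simp [crossLoz, hS.2]⟩
    · rcases Finset.mem_union.1 hp with hp | hp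
      · obtain ⟨l, hl, he⟩ := hd₁ (p, q) ⟨hp, dnT_notMem_upRow⟩
        exact ⟨l, by simp only [Finset.mem_union]; tauto, he⟩
      · obtain ⟨l, hl, he⟩ := hd₂ (p, q) ⟨hp, by rwa [dnT_mem_dnRow]⟩
        exact ⟨l, by simp only [Finset.mem_union]; tauto, he⟩
  · have c1 : ∀ l ∈ T₁, ∀ l' ∈ T₂, l.1 = l'.1 → False := fun l hl l' hl' he =>
      hdisj _ (ha₁ l hl).2.1.1 (by have := (ha₂ l' hl').2.1.1; rwa [← he] at this)
    have c2 : ∀ l ∈ T₁, ∀ i ∈ S, l.1 = (crossLoz h i).1 → False := fun l hl i hi he =>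
      (ha₁ l hl).2.1.2 (by rw [upT_mem_upRow, he]; exact ⟨hi, rfl⟩)
    have c3 : ∀ l ∈ T₂, ∀ i ∈ S, l.1 = (crossLoz h i).1 → False := fun l hl i hi he =>
      hdisj _ (hS₁ i hi) (by have := (ha₂ l hl).2.1.1; rwa [he] at this)
    intro l hl l' hl' he
    rcases key l hl with hl | hl | ⟨i, hi, rfl⟩ <;>
      rcases key l' hl' with hl' | hl' | ⟨i', hi', rfl⟩
    · exact iu₁ _ hl _ hl' he
    · exact (c1 _ hl _ hl' he).elim
    · exact (c2 _ hl _ hi' he).elim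
    · exact (c1 _ hl' _ hl he.symm).elim
    · exact iu₂ _ hl _ hl' he
    · exact (c3 _ hl _ hi' he).elim
    · exact (c2 _ hl' _ hi he.symm).elim
    · exact (c3 _ hl' _ hi he.symm).elim
    · have : i = i' := by simpa [crossLoz] using he
      rw [this]
  · have c1 : ∀ l ∈ T₁, ∀ l' ∈ T₂, l.2 = l'.2 → False := fun l hl l' hl' he =>
      hdisj _ (ha₁ l hl).2.2.1 (by have := (ha₂ l' hl').2.2.1; rwa [← he] at this)
    have c2 : ∀ l ∈ T₁, ∀ i ∈ S, l.2 = (crossLoz h i).2 → False := fun l hl i hi he =>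
      hdisj _ (ha₁ l hl).2.2.1 (by have := hS₂ i hi; rw [he]; exact this)
    have c3 : ∀ l ∈ T₂, ∀ i ∈ S, l.2 = (crossLoz h i).2 → False := fun l hl i hi he =>
      (ha₂ l hl).2.2.2 (by rw [dnT_mem_dnRow, he]; exact ⟨hi, rfl⟩)
    intro l hl l' hl' he
    rcases key l hl with hl | hl | ⟨i, hi, rfl⟩ <;>
      rcases key l' hl' with hl' | hl' | ⟨i', hi', rfl⟩
    · exact id₁ _ hl _ hl' he
    · exact (c1 _ hl _ hl' he).elim
    · exact (c2 _ hl _ hi' he).elim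
    · exact (c1 _ hl' _ hl he.symm).elim
    · exact id₂ _ hl _ hl' he
    · exact (c3 _ hl _ hi' he).elim
    · exact (c2 _ hl' _ hi he.symm).elim
    · exact (c3 _ hl' _ hi he.symm).elim
    · have : i = i' := by simpa [crossLoz] using he
      rw [this]

/-- Cutting a region along a horizontal lattice line: sum over the set of positions of the
lozenges crossing the line. -/
theorem Mtil_union_eq_sum (h₁ : ∀ t ∈ R₁, h ≤ t.2.2) (h₂ : ∀ t ∈ R₂, t.2.2 < h)
    (hX : ∀ i, i ∈ X ↔ upT i h ∈ R₁ ∧ dnT i (h - 1) ∈ R₂ ∧ crossLoz h i ∉ F) :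
    Mtil (R₁ ∪ R₂) F = ∑ S ∈ X.powerset,
      Mtil (R₁ \ upRow h S) F * Mtil (R₂ \ dnRow (h - 1) S) F := by
  classical
  have cross : ∀ T ∈ tilings (R₁ ∪ R₂) F, ∀ i, crossLoz h i ∈ T → i ∈ X := by
    intro T hT i hi
    rw [mem_tilings] at hT
    obtain ⟨-, h3, h4⟩ := hT.1.1 _ hi
    refine (hX i).2 ⟨?_, ?_, hT.2 _ hi⟩
    · rcases Finset.mem_union.1 h3 with h3 | h3
      · exact h3
      · have := h₂ _ h3
        simp [crossLoz, upT] at this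
    · rcases Finset.mem_union.1 h4 with h4 | h4
      · have := h₁ _ h4
        simp [crossLoz, dnT] at this
      · exact h4
  unfold Mtil
  rw [Finset.card_eq_sum_card_fiberwise (f := fun T => X.filter fun i => crossLoz h i ∈ T)
    (t := X.powerset) (fun T _ => Finset.mem_coe.2 (Finset.mem_powerset.2 (Finset.filter_subset _ _)))]
  refine Finset.sum_congr rfl fun S hS => ?_
  rw [Finset.mem_powerset] at hS
  rw [← Finset.card_product]
  refine Finset.card_nbij'
    (fun T => (T.filter fun l => h ≤ l.2.2, T.filter fun l => l.1.2 < h))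
    (fun P => P.1 ∪ P.2 ∪ S.image (crossLoz h)) ?_ ?_ ?_ ?_
  · intro T hT
    rw [Finset.mem_coe, Finset.mem_filter] at hT
    obtain ⟨hT, rfl⟩ := hT
    have hc := cross T hT
    rw [mem_tilings] at hT
    rw [Finset.mem_coe, Finset.mem_product, mem_tilings, mem_tilings]
    exact ⟨⟨isTiling_upper_of_isTiling h₁ h₂ hT.1 hc,
        fun l hl => hT.2 l (Finset.mem_filter.1 hl).1⟩,
      ⟨isTiling_lower_of_isTiling h₁ h₂ hT.1 hc,
        fun l hl => hT.2 l (Finset.mem_filter.1 hl).1⟩⟩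
  · rintro ⟨T₁, T₂⟩ hT
    rw [Finset.mem_coe, Finset.mem_product, mem_tilings, mem_tilings] at hT
    obtain ⟨⟨hT₁, hF₁⟩, ⟨hT₂, hF₂⟩⟩ := hT
    rw [Finset.mem_coe, Finset.mem_filter, mem_tilings]
    refine ⟨⟨isTiling_glue h₁ h₂ (fun i hi => ((hX i).1 (hS hi)).1)
      (fun i hi => ((hX i).1 (hS hi)).2.1) hT₁ hT₂, ?_⟩, ?_⟩
    · intro l hl
      simp only [Finset.mem_union, Finset.mem_image] at hl
      rcases hl with (hl | hl) | ⟨i, hi, rfl⟩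
      · exact hF₁ l hl
      · exact hF₂ l hl
      · exact ((hX i).1 (hS hi)).2.2
    · ext i
      simp only [Finset.mem_union, Finset.mem_image, Finset.mem_filter]
      constructor
      · rintro ⟨hi, (hl | hl) | ⟨i', hi', he⟩⟩
        · have := h₁ _ (Finset.mem_sdiff.1 (hT₁.1 _ hl).2.2).1
          simp [crossLoz, dnT] at this
        · have := h₂ _ (Finset.mem_sdiff.1 (hT₂.1 _ hl).2.1).1
          simp [crossLoz, upT] at this
        · simp only [crossLoz, Prod.mk.injEq] at he
          rwa [← he.1.1]
      · intro hi
        exact ⟨hS hi, Or.inr ⟨i, hi, rfl⟩⟩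
  · intro T hT
    rw [Finset.mem_coe, Finset.mem_filter] at hT
    obtain ⟨hT, rfl⟩ := hT
    have hc := cross T hT
    rw [mem_tilings] at hT
    ext ⟨⟨a, b⟩, ⟨c, d⟩⟩
    simp only [Finset.mem_union, Finset.mem_filter, mem_image_crossLoz]
    constructor
    · rintro ((hl | hl) | ⟨⟨-, hl⟩, rfl, rfl, rfl⟩)
      · exact hl.1
      · exact hl.1
      · exact hl
    · intro hl
      have hadj := (hT.1.1 _ hl).1
      simp only [lozAdj, Prod.mk.injEq] at hadj
      by_cases hb : b < h
      · tauto
      by_cases hd : h ≤ d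
      · tauto
      right
      have h5 : b = h ∧ c = a ∧ d = h - 1 := by omega
      obtain ⟨rfl, rfl, rfl⟩ := h5
      exact ⟨⟨hc _ hl, hl⟩, rfl, rfl, rfl⟩
  · rintro ⟨T₁, T₂⟩ hT
    rw [Finset.mem_coe, Finset.mem_product, mem_tilings, mem_tilings] at hT
    obtain ⟨⟨hT₁, -⟩, ⟨hT₂, -⟩⟩ := hT
    have r₁ : ∀ l ∈ T₁, h ≤ l.1.2 ∧ h ≤ l.2.2 := fun l hl =>
      ⟨h₁ _ (Finset.mem_sdiff.1 (hT₁.1 _ hl).2.1).1, h₁ _ (Finset.mem_sdiff.1 (hT₁.1 _ hl).2.2).1⟩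
    have r₂ : ∀ l ∈ T₂, l.1.2 < h ∧ l.2.2 < h := fun l hl =>
      ⟨h₂ _ (Finset.mem_sdiff.1 (hT₂.1 _ hl).2.1).1, h₂ _ (Finset.mem_sdiff.1 (hT₂.1 _ hl).2.2).1⟩
    simp only [Prod.mk.injEq]
    constructor
    · ext ⟨⟨a, b⟩, ⟨c, d⟩⟩
      simp only [Finset.mem_union, Finset.mem_filter, mem_image_crossLoz]
      constructor
      · rintro ⟨(hl | hl) | hl, hh⟩
        · exact hl
        · have := (r₂ _ hl).2
          simp only at this
          omega
        · omega
      · intro hl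
        exact ⟨Or.inl (Or.inl hl), (r₁ _ hl).2⟩
    · ext ⟨⟨a, b⟩, ⟨c, d⟩⟩
      simp only [Finset.mem_union, Finset.mem_filter, mem_image_crossLoz]
      constructor
      · rintro ⟨(hl | hl) | hl, hh⟩
        · have := (r₁ _ hl).1
          simp only at this
          omega
        · exact hl
        · omega
      · intro hl
        exact ⟨Or.inl (Or.inr hl), (r₂ _ hl).1⟩

end Split

/-- The number of elements of `S` that are at most `t`. -/
def countLE (S : Finset ℤ) (t : ℤ) : ℤ := (S.filter (· ≤ t)).card

theorem countLE_eq_add (S : Finset ℤ) (t : ℤ) :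
    countLE S t = countLE S (t - 1) + if t ∈ S then 1 else 0 := by
  unfold countLE
  split_ifs with h
  · have : S.filter (· ≤ t) = insert t (S.filter (· ≤ t - 1)) := by
      ext i
      simp only [Finset.mem_filter, Finset.mem_insert]
      constructor
      · rintro ⟨h1, h2⟩
        by_cases h3 : i = t
        · exact Or.inl h3
        · exact Or.inr ⟨h1, by omega⟩
      · rintro (rfl | ⟨h1, h2⟩)
        · exact ⟨h, le_rfl⟩
        · exact ⟨h1, by omega⟩
    rw [this, Finset.card_insert_of_notMem (by simp)]
    push_cast
    ring
  · have : S.filter (· ≤ t) = S.filter (· ≤ t - 1) := by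
      ext i
      simp only [Finset.mem_filter]
      constructor
      · rintro ⟨h1, h2⟩
        have : i ≠ t := fun h3 => h (h3 ▸ h1)
        exact ⟨h1, by omega⟩
      · rintro ⟨h1, h2⟩
        exact ⟨h1, by omega⟩
    rw [this, add_zero]

theorem countLE_eq_zero {S : Finset ℤ} {t : ℤ} (h : ∀ i ∈ S, t < i) : countLE S t = 0 := by
  unfold countLE
  rw [Finset.filter_false_of_mem (fun i hi => by have := h i hi; omega)]
  rfl

theorem countLE_eq_card {S : Finset ℤ} {t : ℤ} (h : ∀ i ∈ S, i ≤ t) :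
    countLE S t = S.card := by
  unfold countLE
  rw [Finset.filter_true_of_mem h]

theorem countLE_mono (S : Finset ℤ) {s t : ℤ} (h : s ≤ t) : countLE S s ≤ countLE S t := by
  unfold countLE
  exact_mod_cast Finset.card_le_card
    (Finset.monotone_filter_right S fun i _ (hi : i ≤ s) => hi.trans h)

theorem exists_lt_of_finsets (P Q : Finset ℤ) : ∃ s : ℤ, (∀ i ∈ P, s < i) ∧ ∀ i ∈ Q, s < i := by
  obtain ⟨b, hb⟩ := (P ∪ Q).bddBelow
  refine ⟨b - 1, fun i hi => ?_, fun i hi => ?_⟩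
  · have := hb (Finset.mem_coe.2 (Finset.mem_union_left _ hi))
    omega
  · have := hb (Finset.mem_coe.2 (Finset.mem_union_right _ hi))
    omega

/-- The condition for a single row with up-pointing triangles at `P` and down-pointing
triangles at `Q` to be tileable. -/
def RowCond (P Q : Finset ℤ) : Prop :=
  ∀ t : ℤ, (0 ≤ countLE P t - countLE Q (t - 1) ∧ countLE P t - countLE Q (t - 1) ≤ 1) ∧
    0 ≤ countLE Q t - countLE P t ∧ countLE Q t - countLE P t ≤ 1

theorem upT_mem_row {j a b : ℤ} {P Q : Finset ℤ} :
    ((true, a, b) : Tri) ∈ upRow j P ∪ dnRow j Q ↔ a ∈ P ∧ b = j := by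
  rw [Finset.mem_union, upT_mem_upRow, or_iff_left upT_notMem_dnRow]

theorem dnT_mem_row {j a b : ℤ} {P Q : Finset ℤ} :
    ((false, a, b) : Tri) ∈ upRow j P ∪ dnRow j Q ↔ a ∈ Q ∧ b = j := by
  rw [Finset.mem_union, dnT_mem_dnRow, or_iff_right dnT_notMem_upRow]

theorem countLE_of_isTiling_row {j : ℤ} {P Q : Finset ℤ} {T : Finset Loz}
    (hT : IsTiling (upRow j P ∪ dnRow j Q) T) (t : ℤ) :
    countLE P t - countLE Q (t - 1) = (if ((t, j), (t, j)) ∈ T then 1 else 0) ∧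
      countLE Q t - countLE P t = (if ((t + 1, j), (t, j)) ∈ T then 1 else 0) := by
  rw [isTiling_iff] at hT
  obtain ⟨ha, hu, hd, iu, id⟩ := hT
  have hP : ∀ t, (if t ∈ P then (1 : ℤ) else 0) =
      (if ((t, j), (t, j)) ∈ T then 1 else 0) + if ((t, j), (t - 1, j)) ∈ T then 1 else 0 := by
    intro t
    have h1 : ((t, j), (t, j)) ∈ T → t ∈ P := fun h => (upT_mem_row.1 (ha _ h).2.1).1
    have h2 : ((t, j), (t - 1, j)) ∈ T → t ∈ P := fun h => (upT_mem_row.1 (ha _ h).2.1).1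
    have h3 : ¬(((t, j), (t, j)) ∈ T ∧ ((t, j), (t - 1, j)) ∈ T) := by
      rintro ⟨h3, h4⟩
      have := iu _ h3 _ h4 rfl
      simp at this
      omega
    have h4 : t ∈ P → ((t, j), (t, j)) ∈ T ∨ ((t, j), (t - 1, j)) ∈ T := by
      intro h
      obtain ⟨⟨⟨a, b⟩, ⟨c, d⟩⟩, hl, he⟩ := hu (t, j) (upT_mem_row.2 ⟨h, rfl⟩)
      have h5 := ha _ hl
      have h6 := (dnT_mem_row.1 h5.2.2).2
      simp only [lozAdj, Prod.mk.injEq] at h5 he h6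
      obtain ⟨rfl, rfl⟩ := he
      subst h6
      rcases h5.1 with ⟨rfl, -⟩ | ⟨rfl, -⟩ | ⟨-, h7⟩
      · exact Or.inl hl
      · exact Or.inr hl
      · omega
    split_ifs <;> tauto
  have hQ : ∀ t, (if t ∈ Q then (1 : ℤ) else 0) =
      (if ((t, j), (t, j)) ∈ T then 1 else 0) + if ((t + 1, j), (t, j)) ∈ T then 1 else 0 := by
    intro t
    have h1 : ((t, j), (t, j)) ∈ T → t ∈ Q := fun h => (dnT_mem_row.1 (ha _ h).2.2).1
    have h2 : ((t + 1, j), (t, j)) ∈ T → t ∈ Q := fun h => (dnT_mem_row.1 (ha _ h).2.2).1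
    have h3 : ¬(((t, j), (t, j)) ∈ T ∧ ((t + 1, j), (t, j)) ∈ T) := by
      rintro ⟨h3, h4⟩
      have := id _ h3 _ h4 rfl
      simp at this
    have h4 : t ∈ Q → ((t, j), (t, j)) ∈ T ∨ ((t + 1, j), (t, j)) ∈ T := by
      intro h
      obtain ⟨⟨⟨a, b⟩, ⟨c, d⟩⟩, hl, he⟩ := hd (t, j) (dnT_mem_row.2 ⟨h, rfl⟩)
      have h5 := ha _ hl
      have h6 := (upT_mem_row.1 h5.2.1).2
      simp only [lozAdj, Prod.mk.injEq] at h5 he h6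
      obtain ⟨rfl, rfl⟩ := he
      subst h6
      rcases h5.1 with ⟨rfl, -⟩ | ⟨rfl, -⟩ | ⟨-, h7⟩
      · exact Or.inl hl
      · exact Or.inr (by simpa using hl)
      · omega
    split_ifs <;> tauto
  have main : ∀ t, countLE Q t - countLE P t =
      if ((t + 1, j), (t, j)) ∈ T then 1 else 0 := by
    obtain ⟨s, hsP, hsQ⟩ := exists_lt_of_finsets P Q
    have low : ∀ t ≤ s, countLE Q t - countLE P t =
        if ((t + 1, j), (t, j)) ∈ T then 1 else 0 := by
      intro t ht
      rw [countLE_eq_zero fun i hi => ht.trans_lt (hsP i hi),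
        countLE_eq_zero fun i hi => ht.trans_lt (hsQ i hi), if_neg]
      · rfl
      · intro h
        have := hsQ _ (dnT_mem_row.1 (ha _ h).2.2).1
        simp only at this
        omega
    intro t
    rcases le_total t s with h | h
    · exact low t h
    · induction t, h using Int.leInduction with
      | base => exact low s le_rfl
      | succ t ht ih =>
        have h1 := countLE_eq_add P (t + 1)
        have h2 := countLE_eq_add Q (t + 1)
        rw [hP] at h1
        rw [hQ] at h2
        simp only [add_sub_cancel_right] at h1 h2
        linarith
  refine ⟨?_, main t⟩
  have h1 := countLE_eq_add Q t
  rw [hQ t] at h1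
  have h2 := main t
  linarith

theorem exists_isTiling_row {j : ℤ} {P Q : Finset ℤ} (h : RowCond P Q) :
    ∃ T, IsTiling (upRow j P ∪ dnRow j Q) T := by
  refine ⟨(P.filter fun t => countLE P t - countLE Q (t - 1) = 1).image
      (fun t => ((t, j), (t, j))) ∪
    (Q.filter fun t => countLE Q t - countLE P t = 1).image (fun t => ((t + 1, j), (t, j))), ?_⟩
  have hP := countLE_eq_add P
  have hQ := countLE_eq_add Q
  rw [isTiling_iff]
  have key : ∀ a b c d : ℤ, (((a, b), (c, d)) : Loz) ∈
      (P.filter fun t => countLE P t - countLE Q (t - 1) = 1).image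
        (fun t => (((t, j), (t, j)) : Loz)) ∪
      (Q.filter fun t => countLE Q t - countLE P t = 1).image
        (fun t => (((t + 1, j), (t, j)) : Loz)) ↔
      b = j ∧ d = j ∧ ((c = a ∧ countLE P a - countLE Q (a - 1) = 1) ∨
        (c = a - 1 ∧ countLE Q (a - 1) - countLE P (a - 1) = 1)) ∧ a ∈ P ∧ c ∈ Q := by
    intro a b c d
    simp only [Finset.mem_union, Finset.mem_image, Finset.mem_filter, Prod.mk.injEq]
    constructor
    · rintro (⟨t, ⟨h1, h2⟩, ⟨rfl, rfl⟩, ⟨rfl, rfl⟩⟩ | ⟨t, ⟨h1, h2⟩, ⟨rfl, rfl⟩, ⟨rfl, rfl⟩⟩)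
      · refine ⟨rfl, rfl, Or.inl ⟨rfl, h2⟩, h1, ?_⟩
        by_contra h3
        have := hQ t
        rw [if_neg h3] at this
        have := h t
        omega
      · refine ⟨rfl, rfl, Or.inr ⟨by ring, by simpa using h2⟩, ?_, h1⟩
        by_contra h3
        have := hP (t + 1)
        rw [if_neg h3] at this
        have := h (t + 1)
        simp only [add_sub_cancel_right] at *
        omega
    · rintro ⟨rfl, rfl, ⟨rfl, h2⟩ | ⟨rfl, h2⟩, h3, h4⟩
      · exact Or.inl ⟨_, ⟨h3, h2⟩, ⟨rfl, rfl⟩, rfl, rfl⟩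
      · exact Or.inr ⟨_, ⟨h4, h2⟩, ⟨by ring, rfl⟩, rfl, rfl⟩
  have hP' : ∀ a ∈ P, countLE P a - countLE Q (a - 1) = 1 ∨
      countLE Q (a - 1) - countLE P (a - 1) = 1 := by
    intro a ha
    have h1 := hP a
    rw [if_pos ha] at h1
    have := h a
    have := h (a - 1)
    omega
  have hQ' : ∀ a ∈ Q, countLE P a - countLE Q (a - 1) = 1 ∨
      countLE Q a - countLE P a = 1 := by
    intro a ha
    have h1 := hQ a
    rw [if_pos ha] at h1
    have := h a
    omega
  have hQ0 : ∀ a, countLE P a - countLE Q (a - 1) = 1 → countLE Q a - countLE P a ≠ 1 := by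
    intro a h1 h2
    have h3 := hQ a
    split_ifs at h3 <;> omega
  have hP0 : ∀ a, countLE P a - countLE Q (a - 1) = 1 →
      countLE Q (a - 1) - countLE P (a - 1) ≠ 1 := by
    intro a h1 h2
    have h3 := hP a
    split_ifs at h3 <;> omega
  have hPm : ∀ a, countLE P a - countLE Q (a - 1) = 1 → a ∈ P ∧ a ∈ Q := by
    intro a h1
    have h3 := hP a
    have h4 := hQ a
    have := h a
    have := h (a - 1)
    constructor <;> by_contra h5 <;> simp only [h5, if_false] at h3 h4 <;> omega
  have hQm : ∀ a, countLE Q a - countLE P a = 1 → a ∈ Q ∧ a + 1 ∈ P := by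
    intro a h1
    have h3 := hP (a + 1)
    have h4 := hQ a
    have := h a
    have := h (a + 1)
    simp only [add_sub_cancel_right] at *
    constructor <;> by_contra h5 <;> simp only [h5, if_false] at h3 h4 <;> omega
  refine ⟨?_, ?_, ?_, ?_, ?_⟩
  · rintro ⟨⟨a, b⟩, ⟨c, d⟩⟩ hl
    rw [key] at hl
    obtain ⟨rfl, rfl, h1, h2, h3⟩ := hl
    refine ⟨?_, upT_mem_row.2 ⟨h2, rfl⟩, dnT_mem_row.2 ⟨h3, rfl⟩⟩
    simp only [lozAdj, Prod.mk.injEq]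
    tauto
  · rintro ⟨a, b⟩ hp
    obtain ⟨h1, rfl⟩ := upT_mem_row.1 hp
    rcases hP' a h1 with h2 | h2
    · exact ⟨((a, b), (a, b)), (key _ _ _ _).2 ⟨rfl, rfl, Or.inl ⟨rfl, h2⟩, hPm a h2⟩, rfl⟩
    · exact ⟨((a, b), (a - 1, b)),
        (key _ _ _ _).2 ⟨rfl, rfl, Or.inr ⟨rfl, h2⟩, h1, (hQm _ h2).1⟩, rfl⟩
  · rintro ⟨a, b⟩ hp
    obtain ⟨h1, rfl⟩ := dnT_mem_row.1 hp
    rcases hQ' a h1 with h2 | h2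
    · exact ⟨((a, b), (a, b)), (key _ _ _ _).2 ⟨rfl, rfl, Or.inl ⟨rfl, h2⟩, hPm a h2⟩, rfl⟩
    · exact ⟨((a + 1, b), (a, b)), (key _ _ _ _).2
        ⟨rfl, rfl, Or.inr ⟨by ring, by simpa using h2⟩, (hQm _ h2).2, h1⟩, rfl⟩
  · rintro ⟨⟨a, b⟩, ⟨c, d⟩⟩ hl ⟨⟨a', b'⟩, ⟨c', d'⟩⟩ hl' he
    rw [key] at hl hl'
    simp only [Prod.mk.injEq] at he ⊢
    obtain ⟨rfl, rfl⟩ := he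
    have := hP0 a
    refine ⟨⟨rfl, rfl⟩, ?_, by omega⟩
    rcases hl.2.2.1 with h1 | h1 <;> rcases hl'.2.2.1 with h2 | h2
    · omega
    · exact (this h1.2 h2.2).elim
    · exact (this h2.2 h1.2).elim
    · omega
  · rintro ⟨⟨a, b⟩, ⟨c, d⟩⟩ hl ⟨⟨a', b'⟩, ⟨c', d'⟩⟩ hl' he
    rw [key] at hl hl'
    simp only [Prod.mk.injEq] at he ⊢
    obtain ⟨rfl, rfl⟩ := he
    have := hQ0 c
    refine ⟨⟨?_, by omega⟩, rfl, rfl⟩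
    rcases hl.2.2.1 with h1 | h1 <;> rcases hl'.2.2.1 with h2 | h2
    · omega
    · exact (this (h1.1 ▸ h1.2) (h2.1 ▸ h2.2)).elim
    · exact (this (h2.1 ▸ h2.2) (h1.1 ▸ h1.2)).elim
    · omega

open Classical in
theorem Mtil_row (j : ℤ) (P Q : Finset ℤ) :
    Mtil (upRow j P ∪ dnRow j Q) ∅ = if RowCond P Q then 1 else 0 := by
  unfold Mtil
  split_ifs with h
  · obtain ⟨T, hT⟩ := exists_isTiling_row (j := j) h
    rw [Finset.card_eq_one]
    refine ⟨T, Finset.eq_singleton_iff_unique_mem.2 ⟨(mem_tilings _ _ _).2 ⟨hT, by simp⟩, ?_⟩⟩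
    intro T' hT'
    have hT' := ((mem_tilings _ _ _).1 hT').1
    have sub : ∀ T T', IsTiling (upRow j P ∪ dnRow j Q) T → IsTiling (upRow j P ∪ dnRow j Q) T' →
        T ⊆ T' := by
      rintro T T' hT hT' ⟨⟨a, b⟩, ⟨c, d⟩⟩ hl
      have h1 := hT.1 _ hl
      have h2 := (upT_mem_row.1 h1.2.1).2
      have h3 := (dnT_mem_row.1 h1.2.2).2
      have h4 := h1.1
      simp only [lozAdj, Prod.mk.injEq] at h2 h3 h4
      subst h2 h3
      rcases h4 with ⟨rfl, -⟩ | ⟨rfl, -⟩ | h4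
      · have h5 := (countLE_of_isTiling_row hT c).1
        rw [if_pos hl, (countLE_of_isTiling_row hT' c).1] at h5
        by_contra h6
        simp [h6] at h5
      · have h5 := (countLE_of_isTiling_row hT (a - 1)).2
        rw [if_pos (by simpa using hl), (countLE_of_isTiling_row hT' (a - 1)).2] at h5
        by_contra h6
        simp [h6] at h5
      · omega
    exact (sub T' T hT' hT).antisymm (sub T T' hT hT')
  · rw [Finset.card_eq_zero, Finset.eq_empty_iff_forall_notMem]
    intro T hT
    apply h
    intro t
    obtain ⟨h1, h2⟩ := countLE_of_isTiling_row ((mem_tilings _ _ _).1 hT).1 t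
    rw [h1, h2]
    split_ifs <;> simp

/-- `B` interlaces `A`: `a₁ ≤ b₁ < a₂ ≤ b₂ < ⋯ ≤ bₖ < aₖ₊₁`, in terms of counting functions. -/
def Interlaces (A B : Finset ℤ) : Prop :=
  A.card = B.card + 1 ∧
    ∀ t : ℤ, countLE B t ≤ countLE A t ∧ countLE A t ≤ countLE B (t - 1) + 1

theorem countLE_sdiff {S A : Finset ℤ} (h : A ⊆ S) (t : ℤ) :
    countLE (S \ A) t = countLE S t - countLE A t := by
  have h1 : (S \ A).filter (· ≤ t) = S.filter (· ≤ t) \ A.filter (· ≤ t) := by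
    ext i
    simp only [Finset.mem_filter, Finset.mem_sdiff]
    tauto
  have h2 := Finset.card_sdiff_add_card_eq_card
    (Finset.filter_subset_filter (fun i => i ≤ t) h)
  unfold countLE
  rw [h1]
  omega

theorem countLE_Ico (s e t : ℤ) : countLE (Finset.Ico s e) t = max 0 (min (t + 1) e - s) := by
  have : (Finset.Ico s e).filter (· ≤ t) = Finset.Ico s (min (t + 1) e) := by
    ext i
    simp only [Finset.mem_filter, Finset.mem_Ico]
    omega
  unfold countLE
  rw [this, Int.card_Ico]
  omega

theorem rowCond_iff_interlaces {s e : ℤ} (hse : s < e) {A B : Finset ℤ}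
    (hA : A ⊆ Finset.Ico s e) (hB : B ⊆ Finset.Ico s (e - 1)) :
    RowCond (Finset.Ico s e \ A) (Finset.Ico s (e - 1) \ B) ↔ Interlaces A B := by
  have lowA : ∀ t < s, countLE A t = 0 := fun t ht => countLE_eq_zero fun i hi => by
    have := Finset.mem_Ico.1 (hA hi)
    omega
  have lowB : ∀ t < s, countLE B t = 0 := fun t ht => countLE_eq_zero fun i hi => by
    have := Finset.mem_Ico.1 (hB hi)
    omega
  have highA : ∀ t, e - 1 ≤ t → countLE A t = A.card := fun t ht => countLE_eq_card fun i hi => by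
    have := Finset.mem_Ico.1 (hA hi)
    omega
  have highB : ∀ t, e - 2 ≤ t → countLE B t = B.card := fun t ht => countLE_eq_card fun i hi => by
    have := Finset.mem_Ico.1 (hB hi)
    omega
  unfold RowCond Interlaces
  simp only [countLE_sdiff hA, countLE_sdiff hB, countLE_Ico]
  constructor
  · intro h
    have hc : A.card = B.card + 1 := by
      have h1 := h e
      rw [highA e (by omega), highB e (by omega), highB (e - 1) (by omega)] at h1
      omega
    refine ⟨hc, fun t => ?_⟩
    have h1 := h t
    have h2 := highA t
    have h3 := highB t
    have h4 := highB (t - 1)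
    have h5 := lowA t
    have h6 := lowB t
    have h7 := lowB (t - 1)
    omega
  · rintro ⟨hc, h⟩ t
    have h1 := h t
    have h2 := highA t
    have h3 := highB t
    have h4 := highB (t - 1)
    have h5 := lowA t
    have h6 := lowB t
    have h7 := lowB (t - 1)
    have h8 := h (t - 1)
    have h9 := countLE_mono A (show t - 1 ≤ t by omega)
    have h10 := countLE_mono B (show t - 1 ≤ t by omega)
    omega

theorem countLE_image {κ : ℕ} {a : Fin κ → ℤ} (ha : StrictMono a) (t : ℤ) :
    countLE (Finset.univ.image a) t = ((Finset.univ.filter fun i => a i ≤ t).card : ℤ) := by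
  unfold countLE
  rw [Finset.filter_image, Finset.card_image_of_injective _ ha.injective]

/-- The tuples `b` with `a₀ ≤ b₀ < a₁ ≤ b₁ < ⋯`. -/
noncomputable def interlacingTuples {κ : ℕ} (a : Fin (κ + 1) → ℤ) : Finset (Fin κ → ℤ) :=
  Fintype.piFinset fun i => Finset.Ico (a i.castSucc) (a i.succ)

theorem mem_interlacingTuples {κ : ℕ} {a : Fin (κ + 1) → ℤ} {b : Fin κ → ℤ} :
    b ∈ interlacingTuples a ↔ ∀ i : Fin κ, a i.castSucc ≤ b i ∧ b i < a i.succ := by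
  simp [interlacingTuples, Fintype.mem_piFinset]

theorem strictMono_of_mem_interlacingTuples {κ : ℕ} {a : Fin (κ + 1) → ℤ} (ha : StrictMono a)
    {b : Fin κ → ℤ} (hb : b ∈ interlacingTuples a) : StrictMono b := by
  rw [mem_interlacingTuples] at hb
  intro i j hij
  have h1 : a i.succ ≤ a j.castSucc := ha.monotone (by
    rw [Fin.le_def]; simpa using hij)
  exact ((hb i).2.trans_le h1).trans_le (hb j).1

theorem interlaces_image {κ : ℕ} {a : Fin (κ + 1) → ℤ} (ha : StrictMono a)
    {b : Fin κ → ℤ} (hb : b ∈ interlacingTuples a) :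
    Interlaces (Finset.univ.image a) (Finset.univ.image b) := by
  have hbm := strictMono_of_mem_interlacingTuples ha hb
  rw [mem_interlacingTuples] at hb
  refine ⟨?_, fun t => ⟨?_, ?_⟩⟩
  · rw [Finset.card_image_of_injective _ ha.injective,
      Finset.card_image_of_injective _ hbm.injective]
    simp
  · rw [countLE_image ha, countLE_image hbm]
    norm_cast
    refine Finset.card_le_card_of_injOn Fin.castSucc ?_ (Fin.castSucc_injective _).injOn
    intro i hi
    simp only [Finset.coe_filter, Finset.mem_univ, true_and, Set.mem_ofPred_eq] at hi ⊢
    exact (hb i).1.trans hi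
  · rw [countLE_image ha, countLE_image hbm]
    norm_cast
    have : (Finset.univ.filter fun i => a i ≤ t) ⊆
        insert 0 ((Finset.univ.filter fun i => b i ≤ t - 1).image Fin.succ) := by
      intro i hi
      simp only [Finset.mem_filter, Finset.mem_univ, true_and, Finset.mem_insert,
        Finset.mem_image] at hi ⊢
      induction i using Fin.cases with
      | zero => exact Or.inl rfl
      | succ i =>
        refine Or.inr ⟨i, ?_, rfl⟩
        have := (hb i).2
        omega
    refine (Finset.card_le_card this).trans ((Finset.card_insert_le _ _).trans ?_)
    exact Nat.add_le_add_right Finset.card_image_le 1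

theorem exists_of_interlaces {κ : ℕ} {a : Fin (κ + 1) → ℤ} (ha : StrictMono a)
    {B : Finset ℤ} (hB : Interlaces (Finset.univ.image a) B) :
    ∃ b ∈ interlacingTuples a, Finset.univ.image b = B := by
  obtain ⟨hc, h⟩ := hB
  rw [Finset.card_image_of_injective _ ha.injective, Finset.card_univ, Fintype.card_fin] at hc
  have hκ : B.card = κ := by omega
  set b := B.orderEmbOfFin hκ with hb
  have hbi : Finset.univ.image b = B := by
    apply Finset.coe_injective
    rw [Finset.coe_image, Finset.coe_univ, Set.image_univ, hb, Finset.range_orderEmbOfFin]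
  have hbm : StrictMono b := b.strictMono
  refine ⟨b, ?_, hbi⟩
  rw [← hbi] at h
  simp only [countLE_image ha, countLE_image hbm] at h
  rw [mem_interlacingTuples]
  intro i
  obtain ⟨h1, h2⟩ := h (b i)
  norm_cast at h1 h2
  have c1 : (i : ℕ) + 1 ≤ (Finset.univ.filter fun j => b j ≤ b i).card := by
    rw [← Fin.card_Iic i]
    exact Finset.card_le_card fun j hj => by
      simpa [hbm.le_iff_le] using hj
  have c2 : (Finset.univ.filter fun j => b j ≤ b i - 1).card ≤ (i : ℕ) := by
    rw [← Fin.card_Iio i]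
    exact Finset.card_le_card fun j hj => by
      have h3 : b j < b i := by
        have := (Finset.mem_filter.1 hj).2
        omega
      simpa [hbm.lt_iff_lt] using h3
  constructor
  · by_contra! hlt
    have c3 : (Finset.univ.filter fun j => a j ≤ b i).card ≤ (i : ℕ) := by
      rw [← Fin.val_castSucc i, ← Fin.card_Iio i.castSucc]
      exact Finset.card_le_card fun j hj => by
        have h3 : a j < a i.castSucc := (Finset.mem_filter.1 hj).2.trans_lt hlt
        rw [Finset.mem_Iio]
        exact ha.lt_iff_lt.1 h3
    omega
  · by_contra! hlt
    have c3 : (i : ℕ) + 1 + 1 ≤ (Finset.univ.filter fun j => a j ≤ b i).card := by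
      rw [← Fin.val_succ i, ← Fin.card_Iic i.succ]
      exact Finset.card_le_card fun j hj => by
        rw [Finset.mem_Iic] at hj
        simpa using (ha.monotone hj).trans hlt
    omega

open Classical in
theorem sum_interlaces {κ : ℕ} {a : Fin (κ + 1) → ℤ} (ha : StrictMono a) {X : Finset ℤ}
    (hX : ∀ b ∈ interlacingTuples a, Finset.univ.image b ⊆ X) (G : Finset ℤ → ℚ) :
    ∑ B ∈ X.powerset, (if Interlaces (Finset.univ.image a) B then G B else 0) =
      ∑ b ∈ interlacingTuples a, G (Finset.univ.image b) := by
  rw [← Finset.sum_filter]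
  symm
  refine Finset.sum_nbij (fun b => Finset.univ.image b) ?_ ?_ ?_ fun _ _ => rfl
  · intro b hb
    exact Finset.mem_filter.2 ⟨Finset.mem_powerset.2 (hX b hb), interlaces_image ha hb⟩
  · intro b hb b' hb' he
    have h1 := strictMono_of_mem_interlacingTuples ha (Finset.mem_coe.1 hb)
    have h2 := strictMono_of_mem_interlacingTuples ha (Finset.mem_coe.1 hb')
    refine (StrictMono.range_inj h1 h2).1 ?_
    have := congrArg (fun S : Finset ℤ => (S : Set ℤ)) he
    simpa using this
  · intro B hB
    obtain ⟨b, hb, he⟩ := exists_of_interlaces ha (Finset.mem_filter.1 (Finset.mem_coe.1 hB)).2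
    exact ⟨b, hb, he⟩

/-- The normalised product `(a - c + 1) ⋯ (a + c) / (2c)!`. -/
def evenBinom (c : ℕ) (a : ℚ) : ℚ :=
  (∏ i ∈ Finset.range c, (a - i) * (a + 1 + i)) / (2 * c).factorial

/-- The normalised product `(a - c) ⋯ (a + c) / (2c + 1)!`. -/
def oddBinom (c : ℕ) (a : ℚ) : ℚ :=
  (a - c) * (∏ i ∈ Finset.range c, (a - i) * (a + 1 + i)) / (2 * c + 1).factorial

theorem shift_prod (c : ℕ) (a : ℚ) :
    (a + 1 - c) * ∏ i ∈ Finset.range c, (a + 1 - i) * (a + 1 + 1 + i) =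
      (a + 1 + c) * ∏ i ∈ Finset.range c, (a - i) * (a + 1 + i) := by
  induction c with
  | zero => simp
  | succ c ih =>
    rw [Finset.prod_range_succ, Finset.prod_range_succ]
    push_cast
    linear_combination (a - c) * (a + 1 + 1 + c) * ih

theorem oddBinom_add_one_sub (c : ℕ) (a : ℚ) :
    oddBinom c (a + 1) - oddBinom c a = evenBinom c a := by
  unfold oddBinom evenBinom
  rw [shift_prod, Nat.factorial_succ]
  have h1 : ((2 * c).factorial : ℚ) ≠ 0 := by positivity
  have h2 : ((2 * c + 1 : ℕ) : ℚ) ≠ 0 := by positivity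
  push_cast at h2 ⊢
  field_simp
  ring

theorem evenBinom_add_one_sub (c : ℕ) (a : ℚ) :
    evenBinom (c + 1) (a + 1) - evenBinom (c + 1) a = oddBinom c (a + 1) := by
  unfold oddBinom evenBinom
  rw [shift_prod, Finset.prod_range_succ, Finset.prod_range_succ,
    show 2 * (c + 1) = 2 * c + 1 + 1 by ring, Nat.factorial_succ (2 * c + 1)]
  have h1 : ((2 * c + 1).factorial : ℚ) ≠ 0 := by positivity
  have h2 : ((2 * c + 1 + 1 : ℕ) : ℚ) ≠ 0 := by positivity
  have h3 := shift_prod c a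
  push_cast at h2 ⊢
  field_simp
  linear_combination (a + 1 + 1 + c) * h3

theorem evenBinom_zero (a : ℚ) : evenBinom 0 a = 1 := by simp [evenBinom]

theorem oddBinom_zero_right (c : ℕ) : oddBinom c 0 = 0 := by
  unfold oddBinom
  rcases Nat.eq_zero_or_pos c with rfl | hc
  · simp
  · rw [Finset.prod_eq_zero (Finset.mem_range.2 hc) (by simp)]
    simp

theorem sum_Ico_int_sub (F : ℤ → ℚ) {p q : ℤ} (h : p ≤ q) :
    ∑ t ∈ Finset.Ico p q, (F (t + 1) - F t) = F q - F p := by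
  induction q, h using Int.leInduction with
  | base => simp
  | succ q hq ih =>
    rw [← Finset.insert_Ico_right_eq_Ico_add_one hq, Finset.sum_insert (by simp), ih]
    ring

theorem sum_interlacingTuples_det {κ : ℕ} {a : Fin (κ + 1) → ℤ} (ha : StrictMono a)
    (f F : Fin κ → ℤ → ℚ) (hF : ∀ c t, F c (t + 1) - F c t = f c t) :
    ∑ b ∈ interlacingTuples a, (Matrix.of fun r c => f c (b r)).det =
      (Matrix.of fun r c : Fin κ => F c (a r.succ) - F c (a r.castSucc)).det := by
  have h := MultilinearMap.map_sum_finset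
    (Matrix.detRowAlternating (n := Fin κ) (R := ℚ)).toMultilinearMap
    (fun (_ : Fin κ) (t : ℤ) (c : Fin κ) => f c t)
    (fun i => Finset.Ico (a i.castSucc) (a i.succ))
  have h1 : ∀ r c : Fin κ, F c (a r.succ) - F c (a r.castSucc) =
      (∑ t ∈ Finset.Ico (a r.castSucc) (a r.succ), fun c : Fin κ => f c t) c := by
    intro r c
    rw [Finset.sum_apply, ← sum_Ico_int_sub _ (ha.monotone (Fin.castSucc_lt_succ).le)]
    exact Finset.sum_congr rfl fun t _ => hF c t
  simp only [h1]
  exact h.symm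

theorem det_cons_one {κ : ℕ} (x : Fin (κ + 1) → Fin κ → ℚ) :
    (Matrix.of fun r c => (Fin.cons 1 (x r) : Fin (κ + 1) → ℚ) c).det =
      (Matrix.of fun r c : Fin κ => x r.succ c - x r.castSucc c).det := by
  refine (Matrix.det_eq_of_forall_row_eq_smul_add_pred (fun _ => (1 : ℚ))
    (A := Matrix.of fun r c => (Fin.cons 1 (x r) : Fin (κ + 1) → ℚ) c)
    (B := Matrix.of fun r c => (Fin.cases (Fin.cons 1 (x 0))
      (fun r => Fin.cons 0 fun c => x r.succ c - x r.castSucc c) r : Fin (κ + 1) → ℚ) c)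
    (fun j => rfl) ?_).trans ?_
  rotate_left
  · rw [Matrix.det_succ_column_zero, Fin.sum_univ_succ]
    simp only [Matrix.of_apply, Fin.cases_succ, Fin.cons_zero, mul_zero, zero_mul,
      Finset.sum_const_zero, add_zero]
    simp only [Fin.val_zero, pow_zero, Fin.cases_zero, Fin.cons_zero, one_mul]
    rfl
  · intro i j
    simp only [Matrix.of_apply, Fin.cases_succ]
    refine Fin.cases ?_ (fun j => ?_) j
    · simp
    · simp

/-- The number of tilings of the top part of a quartered hexagon starting at an even row. -/
def evenDet (κ : ℕ) (s : ℤ) (a : Fin κ → ℤ) : ℚ :=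
  (Matrix.of fun r c : Fin κ => evenBinom c ((a r - s : ℤ) : ℚ)).det

/-- The number of tilings of the top part of a quartered hexagon starting at an odd row. -/
def oddDet (κ : ℕ) (s : ℤ) (a : Fin κ → ℤ) : ℚ :=
  (Matrix.of fun r c : Fin κ => oddBinom c ((a r - s + 1 : ℤ) : ℚ)).det

theorem sum_oddDet {κ : ℕ} {a : Fin (κ + 1) → ℤ} (ha : StrictMono a) (s : ℤ) :
    ∑ b ∈ interlacingTuples a, oddDet κ s b = evenDet (κ + 1) s a := by
  unfold oddDet evenDet
  rw [sum_interlacingTuples_det ha (fun c t => oddBinom c ((t - s + 1 : ℤ) : ℚ))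
    (fun c t => evenBinom (c + 1) ((t - s : ℤ) : ℚ)),
    ← det_cons_one fun r c => evenBinom (c + 1) ((a r - s : ℤ) : ℚ)]
  · congr 1
    ext r c
    refine Fin.cases ?_ (fun c => ?_) c
    · simp [evenBinom_zero]
    · simp
  · intro c t
    have := evenBinom_add_one_sub c ((t - s : ℤ) : ℚ)
    push_cast at this ⊢
    rw [← this]
    congr 2
    ring

theorem sum_evenDet {κ : ℕ} {s : ℤ} {a : Fin κ → ℤ}
    (ha : StrictMono (Fin.cons (s - 1) a : Fin (κ + 1) → ℤ)) :
    ∑ b ∈ interlacingTuples (Fin.cons (s - 1) a : Fin (κ + 1) → ℤ), evenDet κ (s - 1) b =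
      oddDet κ s a := by
  unfold oddDet evenDet
  rw [sum_interlacingTuples_det ha (fun c t => evenBinom c ((t - (s - 1) : ℤ) : ℚ))
    (fun c t => oddBinom c ((t - (s - 1) : ℤ) : ℚ)),
    ← det_cons_one fun r (c : Fin κ) =>
      oddBinom c (((Fin.cons (s - 1) a : Fin (κ + 1) → ℤ) r - (s - 1) : ℤ) : ℚ),
    Matrix.det_succ_row_zero, Fin.sum_univ_succ]
  · simp only [Matrix.of_apply, Fin.cons_succ, Fin.cons_zero, sub_self, Int.cast_zero,
      oddBinom_zero_right, mul_zero, zero_mul, Finset.sum_const_zero, add_zero, Fin.val_zero,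
      pow_zero, one_mul]
    congr 1
    ext r c
    simp only [Matrix.submatrix_apply, Matrix.of_apply, Fin.cons_succ, Fin.zero_succAbove]
    congr 2
    ring
  · intro c t
    have := oddBinom_add_one_sub c ((t - (s - 1) : ℤ) : ℚ)
    push_cast at this ⊢
    rw [← this]
    congr 2
    ring

theorem evenDet_eq_prod (κ : ℕ) (s : ℤ) (a : Fin κ → ℤ) :
    evenDet κ s a = (∏ c : Fin κ, (((2 * c : ℕ).factorial : ℚ))⁻¹) *
      ∏ i : Fin κ, ∏ j ∈ Finset.Ioi i,
        (((a j - s) * (a j - s + 1) : ℤ) - ((a i - s) * (a i - s + 1) : ℤ) : ℚ) := by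
  have h := Matrix.det_eval_matrixOfPolynomials_eq_det_vandermonde
    (fun i : Fin κ => (((a i - s) * (a i - s + 1) : ℤ) : ℚ))
    (fun c => ∏ i ∈ Finset.range c, (Polynomial.X - Polynomial.C ((i : ℚ) * (i + 1))))
    (fun c => by
      rw [Polynomial.natDegree_prod_of_monic _ _ fun i _ => Polynomial.monic_X_sub_C _]
      simp only [Polynomial.natDegree_X_sub_C, Finset.sum_const, Finset.card_range, smul_eq_mul,
        mul_one])
    (fun c => Polynomial.monic_prod_of_monic _ _ fun i _ => Polynomial.monic_X_sub_C _)
  rw [← Matrix.det_vandermonde, h, ← Matrix.det_mul_row]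
  unfold evenDet
  congr 1
  ext r c
  simp only [Matrix.of_apply, evenBinom, Polynomial.eval_prod, Polynomial.eval_sub,
    Polynomial.eval_X, Polynomial.eval_C]
  rw [div_eq_inv_mul]
  congr 1
  refine Finset.prod_congr rfl fun i _ => ?_
  push_cast
  ring

/-- The row of height `i` of a quartered hexagon with base of width `W`. -/
noncomputable def quarterRow (W : ℤ) (i : ℕ) : Finset Tri :=
  upRow i (Finset.Ico (-((i / 2 : ℕ) : ℤ)) (W - i)) ∪
    dnRow i (Finset.Ico (-(((i + 1) / 2 : ℕ) : ℤ)) (W - i - 1))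

/-- The rows of heights `j, …, m - 1` of a quartered hexagon with base of width `W`. -/
noncomputable def quarterRows (W : ℤ) (m j : ℕ) : Finset Tri :=
  (Finset.Ico j m).biUnion (quarterRow W)

/-- The positions of the up-pointing triangles in the row of height `j`. -/
noncomputable def upPositions (W : ℤ) (m j : ℕ) : Finset ℤ :=
  if j < m then Finset.Ico (-((j / 2 : ℕ) : ℤ)) (W - j) else ∅

theorem upT_mem_quarterRows {W a b : ℤ} {m j : ℕ} :
    ((true, a, b) : Tri) ∈ quarterRows W m j ↔
      (j : ℤ) ≤ b ∧ b < m ∧ -(b / 2) ≤ a ∧ a < W - b := by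
  simp only [quarterRows, quarterRow, Finset.mem_biUnion, upT_mem_row, Finset.mem_Ico]
  constructor
  · rintro ⟨i, h1, h2, rfl⟩
    push_cast at h2
    omega
  · rintro ⟨h1, h2, h3⟩
    lift b to ℕ using by omega
    refine ⟨b, by omega, ?_, rfl⟩
    push_cast
    omega

theorem dnT_mem_quarterRows {W a b : ℤ} {m j : ℕ} :
    ((false, a, b) : Tri) ∈ quarterRows W m j ↔
      (j : ℤ) ≤ b ∧ b < m ∧ -((b + 1) / 2) ≤ a ∧ a < W - b - 1 := by
  simp only [quarterRows, quarterRow, Finset.mem_biUnion, dnT_mem_row, Finset.mem_Ico]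
  constructor
  · rintro ⟨i, h1, h2, rfl⟩
    push_cast at h2
    omega
  · rintro ⟨h1, h2, h3⟩
    lift b to ℕ using by omega
    refine ⟨b, by omega, ?_, rfl⟩
    push_cast
    omega

/-- The tilings of `quarterRows W m j` with dents `A` are counted by `d` when `A` has `κ`
elements, and do not exist otherwise. -/
def TilingsCountedBy (W : ℤ) (m j κ : ℕ) (d : (Fin κ → ℤ) → ℚ) : Prop :=
  ∀ A ⊆ upPositions W m j,
    (A.card ≠ κ → Mtil (quarterRows W m j \ upRow j A) ∅ = 0) ∧
    ∀ a : Fin κ → ℤ, StrictMono a → Finset.univ.image a = A →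
      (Mtil (quarterRows W m j \ upRow j A) ∅ : ℚ) = d a

open Classical in
theorem Mtil_quarterRows_eq_sum {W : ℤ} {m j : ℕ} (hj : j < m) {A A' : Finset ℤ}
    (hW : -(((j + 1) / 2 : ℕ) : ℤ) < W - j)
    (hA' : A' ⊆ Finset.Ico (-(((j + 1) / 2 : ℕ) : ℤ)) (W - j))
    (hAA' : Finset.Ico (-((j / 2 : ℕ) : ℤ)) (W - j) \ A =
      Finset.Ico (-(((j + 1) / 2 : ℕ) : ℤ)) (W - j) \ A') :
    (Mtil (quarterRows W m j \ upRow j A) ∅ : ℚ) =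
      ∑ B ∈ (upPositions W m (j + 1)).powerset, if Interlaces A' B then
        (Mtil (quarterRows W m (j + 1) \ upRow (j + 1 : ℕ) B) ∅ : ℚ) else 0 := by
  have hreg : quarterRows W m j \ upRow j A =
      quarterRows W m (j + 1) ∪ (quarterRow W j \ upRow j A) := by
    have h1 : quarterRows W m j = quarterRow W j ∪ quarterRows W m (j + 1) := by
      unfold quarterRows
      rw [← Finset.insert_Ico_add_one_left_eq_Ico hj, Finset.biUnion_insert]
    have h2 : quarterRows W m (j + 1) \ upRow j A = quarterRows W m (j + 1) := by
      refine Finset.sdiff_eq_self_of_disjoint (Finset.disjoint_left.2 ?_)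
      rintro ⟨_ | _, a, b⟩ h3 h4
      · exact dnT_notMem_upRow h4
      · have := upT_mem_quarterRows.1 h3
        have := upT_mem_upRow.1 h4
        omega
    rw [h1, Finset.union_sdiff_distrib, h2, Finset.union_comm]
  have hX : ∀ i : ℤ, i ∈ upPositions W m (j + 1) ↔
      upT i (j + 1 : ℕ) ∈ quarterRows W m (j + 1) ∧
      dnT i ((j + 1 : ℕ) - 1) ∈ quarterRow W j \ upRow j A ∧
      crossLoz (j + 1 : ℕ) i ∉ (∅ : Finset Loz) := by
    intro i
    rw [Finset.mem_sdiff, dnT, upT, upT_mem_quarterRows, and_iff_left dnT_notMem_upRow,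
      quarterRow, dnT_mem_row, Finset.mem_Ico, upPositions]
    split_ifs with h
    · rw [Finset.mem_Ico]
      simp only [Finset.notMem_empty, not_false_eq_true, and_true]
      push_cast
      omega
    · simp only [Finset.notMem_empty, false_iff]
      omega
  rw [hreg, Mtil_union_eq_sum (h := ((j + 1 : ℕ) : ℤ)) ?_ ?_ hX]
  · push_cast
    refine Finset.sum_congr rfl fun B hB => ?_
    rw [Finset.mem_powerset] at hB
    have hB' : B ⊆ Finset.Ico (-(((j + 1) / 2 : ℕ) : ℤ)) (W - j - 1) := by
      refine hB.trans ?_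
      unfold upPositions
      split_ifs with h
      · intro i
        simp only [Finset.mem_Ico]
        push_cast
        omega
      · exact Finset.empty_subset _
    have hrow : (quarterRow W j \ upRow j A) \ dnRow ((j + 1 : ℕ) - 1) B =
        upRow j (Finset.Ico (-(((j + 1) / 2 : ℕ) : ℤ)) (W - j) \ A') ∪
          dnRow j (Finset.Ico (-(((j + 1) / 2 : ℕ) : ℤ)) (W - j - 1) \ B) := by
      rw [← hAA']
      ext ⟨_ | _, a, b⟩
      · rw [Finset.mem_sdiff, Finset.mem_sdiff, quarterRow, dnT_mem_row, dnT_mem_row,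
          dnT_mem_dnRow, and_iff_left dnT_notMem_upRow, Finset.mem_sdiff]
        push_cast
        rw [add_sub_cancel_right]
        tauto
      · rw [Finset.mem_sdiff, Finset.mem_sdiff, quarterRow, upT_mem_row, upT_mem_row,
          upT_mem_upRow, and_iff_left upT_notMem_dnRow, Finset.mem_sdiff]
        tauto
    have h1 := Mtil_row j (Finset.Ico (-(((j + 1) / 2 : ℕ) : ℤ)) (W - j) \ A')
      (Finset.Ico (-(((j + 1) / 2 : ℕ) : ℤ)) (W - j - 1) \ B)
    rw [← hrow] at h1
    simp only [rowCond_iff_interlaces hW hA' hB'] at h1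
    push_cast at h1
    rw [h1]
    split_ifs <;> simp
  · rintro ⟨_ | _, a, b⟩ ht
    · exact (dnT_mem_quarterRows.1 ht).1
    · exact (upT_mem_quarterRows.1 ht).1
  · rintro ⟨_ | _, a, b⟩ ht
    · have := (dnT_mem_row.1 (Finset.mem_sdiff.1 ht).1).2
      simp only
      omega
    · have := (upT_mem_row.1 (Finset.mem_sdiff.1 ht).1).2
      simp only
      omega

theorem TilingsCountedBy.step {W : ℤ} {m j κ : ℕ} {d : (Fin κ → ℤ) → ℚ}
    (hd : TilingsCountedBy W m (j + 1) κ d) (hj : j < m) (hκ : j + 1 = m → κ = 0)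
    {A A' : Finset ℤ} (hW : -(((j + 1) / 2 : ℕ) : ℤ) < W - j)
    (hA' : A' ⊆ Finset.Ico (-(((j + 1) / 2 : ℕ) : ℤ)) (W - j))
    (hAA' : Finset.Ico (-((j / 2 : ℕ) : ℤ)) (W - j) \ A =
      Finset.Ico (-(((j + 1) / 2 : ℕ) : ℤ)) (W - j) \ A') :
    (A'.card ≠ κ + 1 → Mtil (quarterRows W m j \ upRow j A) ∅ = 0) ∧
    ∀ a : Fin (κ + 1) → ℤ, StrictMono a → Finset.univ.image a = A' →
      (Mtil (quarterRows W m j \ upRow j A) ∅ : ℚ) = ∑ b ∈ interlacingTuples a, d b := by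
  classical
  have hsum := Mtil_quarterRows_eq_sum hj hW hA' hAA'
  constructor
  · intro hc
    have : (Mtil (quarterRows W m j \ upRow j A) ∅ : ℚ) = 0 := by
      rw [hsum]
      refine Finset.sum_eq_zero fun B hB => ?_
      split_ifs with h
      · have := (hd B (Finset.mem_powerset.1 hB)).1 (by have := h.1; omega)
        exact_mod_cast this
      · rfl
    exact_mod_cast this
  · rintro a ha rfl
    have hX : ∀ b ∈ interlacingTuples a, Finset.univ.image b ⊆ upPositions W m (j + 1) := by
      intro b hb t ht
      obtain ⟨i, -, rfl⟩ := Finset.mem_image.1 ht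
      have h1 := mem_interlacingTuples.1 hb i
      have h2 := Finset.mem_Ico.1 (hA' (Finset.mem_image_of_mem a (Finset.mem_univ i.castSucc)))
      have h3 := Finset.mem_Ico.1 (hA' (Finset.mem_image_of_mem a (Finset.mem_univ i.succ)))
      have h4 := i.isLt
      rw [upPositions, if_pos (by omega), Finset.mem_Ico]
      push_cast at *
      omega
    rw [hsum, sum_interlaces ha hX]
    exact Finset.sum_congr rfl fun b hb =>
      (hd _ (hX b hb)).2 b (strictMono_of_mem_interlacingTuples ha hb) rfl

theorem tilingsCountedBy_oddDet {W : ℤ} {m j κ : ℕ} (hj : j < m) (hκ : j + 1 = m → κ = 0)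
    (hodd : j % 2 = 1) (hW : -(((j + 1) / 2 : ℕ) : ℤ) < W - j)
    (hd : TilingsCountedBy W m (j + 1) κ (evenDet κ (-(((j + 1) / 2 : ℕ) : ℤ)))) :
    TilingsCountedBy W m j κ (oddDet κ (-((j / 2 : ℕ) : ℤ))) := by
  intro A hA
  rw [upPositions, if_pos hj] at hA
  have hs : (-(((j + 1) / 2 : ℕ) : ℤ)) = -((j / 2 : ℕ) : ℤ) - 1 := by
    rw [show (j + 1) / 2 = j / 2 + 1 by omega]
    push_cast
    ring
  have hlow : ∀ i ∈ A, -((j / 2 : ℕ) : ℤ) - 1 < i := fun i hi => by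
    have := (Finset.mem_Ico.1 (hA hi)).1
    omega
  have hA' : insert (-(((j + 1) / 2 : ℕ) : ℤ)) A ⊆
      Finset.Ico (-(((j + 1) / 2 : ℕ) : ℤ)) (W - j) := by
    refine Finset.insert_subset (Finset.mem_Ico.2 ⟨le_rfl, hW⟩) (hA.trans ?_)
    exact Finset.Ico_subset_Ico_left (by omega)
  have hAA' : Finset.Ico (-((j / 2 : ℕ) : ℤ)) (W - j) \ A =
      Finset.Ico (-(((j + 1) / 2 : ℕ) : ℤ)) (W - j) \
        insert (-(((j + 1) / 2 : ℕ) : ℤ)) A := by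
    ext i
    simp only [Finset.mem_sdiff, Finset.mem_Ico, Finset.mem_insert, not_or]
    by_cases h : i ∈ A <;> simp only [h, not_true, not_false_eq_true, and_false, and_true]
    omega
  obtain ⟨h1, h2⟩ := hd.step hj hκ hW hA' hAA'
  rw [hs] at h1 h2
  have hnot : (-((j / 2 : ℕ) : ℤ) - 1) ∉ A := fun h => (hlow _ h).false
  refine ⟨fun hc => h1 ?_, ?_⟩
  · rw [Finset.card_insert_of_notMem hnot]
    omega
  · rintro a ha rfl
    have ham : StrictMono (Fin.cons (-((j / 2 : ℕ) : ℤ) - 1) a : Fin (κ + 1) → ℤ) := by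
      refine Fin.strictMono_iff_lt_succ.2 fun i => ?_
      rw [Fin.cons_succ]
      rcases i with ⟨_ | i, hi⟩
      · exact hlow _ (Finset.mem_image_of_mem a (Finset.mem_univ _))
      · exact ha (show (⟨i, by omega⟩ : Fin κ) < ⟨i + 1, hi⟩ by simp [Fin.lt_def])
    rw [h2 _ ham, sum_evenDet ham]
    ext i
    simp [Fin.exists_fin_succ, eq_comm]

theorem tilingsCountedBy_evenDet {W : ℤ} {m j κ : ℕ} (hj : j < m) (hκ : j + 1 = m → κ = 0)
    (heven : j % 2 = 0) (hW : -(((j + 1) / 2 : ℕ) : ℤ) < W - j)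
    (hd : TilingsCountedBy W m (j + 1) κ (oddDet κ (-(((j + 1) / 2 : ℕ) : ℤ)))) :
    TilingsCountedBy W m j (κ + 1) (evenDet (κ + 1) (-((j / 2 : ℕ) : ℤ))) := by
  intro A hA
  rw [upPositions, if_pos hj] at hA
  have hs : (j + 1) / 2 = j / 2 := by omega
  rw [hs] at hd hW
  obtain ⟨h1, h2⟩ := hd.step (A := A) (A' := A) hj hκ (by rwa [hs]) (by rwa [hs]) (by rw [hs])
  refine ⟨h1, fun a ha hi => ?_⟩
  rw [h2 a ha hi, sum_oddDet ha]

theorem Mtil_empty : Mtil ∅ ∅ = 1 := by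
  unfold Mtil
  rw [Finset.card_eq_one]
  refine ⟨∅, Finset.eq_singleton_iff_unique_mem.2 ⟨?_, fun T hT => ?_⟩⟩
  · rw [mem_tilings, isTiling_iff]
    simp
  · rw [mem_tilings] at hT
    refine Finset.eq_empty_iff_forall_notMem.2 fun l hl => ?_
    have := (hT.1.1 l hl).2.1
    simp at this

theorem tilingsCountedBy_quarterRows (N k κ : ℕ) (hκ : κ ≤ k) :
    TilingsCountedBy (N + k) (2 * k) (2 * (k - κ)) κ
      (evenDet κ (-((2 * (k - κ) / 2 : ℕ) : ℤ))) := by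
  induction κ with
  | zero =>
    intro A hA
    rw [upPositions, if_neg (by omega), Finset.subset_empty] at hA
    subst hA
    have : quarterRows (N + k) (2 * k) (2 * (k - 0)) = ∅ := by
      simp [quarterRows]
    rw [this, Finset.empty_sdiff, Mtil_empty]
    simp [evenDet]
  | succ κ ih =>
    have ih := ih (by omega)
    rw [show 2 * (k - κ) = 2 * (k - (κ + 1)) + 1 + 1 by omega] at ih
    exact tilingsCountedBy_evenDet (by omega) (by omega) (by omega) (by omega)
      (tilingsCountedBy_oddDet (by omega) (by omega) (by omega) (by push_cast; omega) ih)

theorem Lreg_eq (k N : ℕ) (A : Finset ℕ) :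
    Lreg (2 * k) N A = quarterRows (N + k) (2 * k) 0 \ upDents A := by
  unfold Lreg
  congr 1
  ext ⟨_ | _, a, b⟩
  · rw [dnT_mem_quarterRows]
    simp only [Finset.mem_biUnion, Finset.mem_range, Finset.mem_union, Finset.mem_image, upT, dnT,
      Prod.mk.injEq, Bool.true_eq_false, false_and, and_false, exists_false, false_or, true_and]
    constructor
    · rintro ⟨j, hj, c, hc, rfl, rfl⟩
      push_cast
      omega
    · rintro ⟨h1, h2, h3, h4⟩
      obtain ⟨b, rfl⟩ := Int.eq_ofNat_of_zero_le (show 0 ≤ b by omega)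
      obtain ⟨c, hc⟩ := Int.eq_ofNat_of_zero_le (show 0 ≤ a + ((b + 1) / 2 : ℕ) by omega)
      exact ⟨b, by omega, c, by omega, by omega, rfl⟩
  · rw [upT_mem_quarterRows]
    simp only [Finset.mem_biUnion, Finset.mem_range, Finset.mem_union, Finset.mem_image, upT, dnT,
      Prod.mk.injEq, Bool.false_eq_true, false_and, and_false, exists_false, or_false, true_and]
    constructor
    · rintro ⟨j, hj, c, hc, rfl, rfl⟩
      push_cast
      omega
    · rintro ⟨h1, h2, h3, h4⟩
      obtain ⟨b, rfl⟩ := Int.eq_ofNat_of_zero_le (show 0 ≤ b by omega)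
      obtain ⟨c, hc⟩ := Int.eq_ofNat_of_zero_le (show 0 ≤ a + (b / 2 : ℕ) by omega)
      exact ⟨b, by omega, c, by omega, by omega, rfl⟩

theorem Mtil_eq_of_forall_notMem {R : Finset Tri} {F : Finset Loz}
    (h : ∀ l ∈ F, upT l.1.1 l.1.2 ∈ R → dnT l.2.1 l.2.2 ∉ R) : Mtil R F = Mtil R ∅ := by
  unfold Mtil
  congr 1
  ext T
  rw [mem_tilings, mem_tilings]
  refine and_congr_right fun hT => ?_
  simp only [Finset.notMem_empty, not_false_eq_true, implies_true, iff_true]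
  intro l hl hF
  exact h l hF (hT.1 l hl).2.1 (hT.1 l hl).2.2

theorem reflTri_involutive : Function.Involutive reflTri := by
  rintro ⟨_ | _, a, b⟩
  · simp [reflTri]
  · simp only [reflTri, if_true, Bool.false_eq_true, if_false, Prod.mk.injEq, true_and]
    omega

theorem reflLoz_involutive : Function.Involutive reflLoz := by
  rintro ⟨⟨a, b⟩, ⟨c, d⟩⟩
  simp only [reflLoz, Prod.mk.injEq]
  omega

theorem reflTri_mem_image {R : Finset Tri} {t : Tri} : reflTri t ∈ R.image reflTri ↔ t ∈ R :=
  reflTri_involutive.injective.mem_finset_image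

theorem IsTiling.reflect {R : Finset Tri} {T : Finset Loz} (hT : IsTiling R T) :
    IsTiling (R.image reflTri) (T.image reflLoz) := by
  have hu : ∀ l : Loz, upT (reflLoz l).1.1 (reflLoz l).1.2 = reflTri (dnT l.2.1 l.2.2) :=
    fun l => by simp [reflLoz, reflTri, upT, dnT]
  have hd : ∀ l : Loz, dnT (reflLoz l).2.1 (reflLoz l).2.2 = reflTri (upT l.1.1 l.1.2) :=
    fun l => by simp [reflLoz, reflTri, upT, dnT]
  constructor
  · intro l' hl'
    obtain ⟨l, hl, rfl⟩ := Finset.mem_image.1 hl'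
    obtain ⟨h1, h2, h3⟩ := hT.1 l hl
    refine ⟨?_, by rwa [hu, reflTri_mem_image], by rwa [hd, reflTri_mem_image]⟩
    obtain ⟨⟨a, b⟩, ⟨c, d⟩⟩ := l
    simp only [lozAdj, reflLoz, Prod.mk.injEq] at h1 ⊢
    omega
  · intro t' ht'
    obtain ⟨t, ht, rfl⟩ := Finset.mem_image.1 ht'
    obtain ⟨l, ⟨hl, hc⟩, hunique⟩ := hT.2 t ht
    refine ⟨reflLoz l, ⟨Finset.mem_image_of_mem _ hl, ?_⟩, ?_⟩
    · rw [hu, hd, reflTri_involutive.injective.eq_iff, reflTri_involutive.injective.eq_iff]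
      exact hc.symm
    · rintro m' ⟨hm', hmc⟩
      obtain ⟨m, hm, rfl⟩ := Finset.mem_image.1 hm'
      rw [hu, hd, reflTri_involutive.injective.eq_iff, reflTri_involutive.injective.eq_iff] at hmc
      rw [hunique m ⟨hm, hmc.symm⟩]

theorem Mtil_image_reflTri (R : Finset Tri) : Mtil (R.image reflTri) ∅ = Mtil R ∅ := by
  have hTri : ∀ R : Finset Tri, (R.image reflTri).image reflTri = R := fun R => by
    rw [Finset.image_image, reflTri_involutive.comp_self, Finset.image_id]
  have hLoz : ∀ T : Finset Loz, (T.image reflLoz).image reflLoz = T := fun T => by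
    rw [Finset.image_image, reflLoz_involutive.comp_self, Finset.image_id]
  unfold Mtil
  refine Finset.card_nbij' (fun T => T.image reflLoz) (fun T => T.image reflLoz) ?_ ?_
    (fun T _ => hLoz T) (fun T _ => hLoz T)
  · intro T hT
    rw [Finset.mem_coe, mem_tilings] at hT ⊢
    refine ⟨?_, fun l _ => Finset.notMem_empty l⟩
    have := hT.1.reflect
    rwa [hTri] at this
  · intro T hT
    rw [Finset.mem_coe, mem_tilings] at hT ⊢
    exact ⟨hT.1.reflect, fun l _ => Finset.notMem_empty l⟩

/-- The number of tilings of the quartered hexagon with `2 * k` rows and base of width `N + k`,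
with the up-pointing triangles at the positions `A` (counted from `0`) of the base removed. -/
noncomputable def quarterCount (k N : ℕ) (A : Finset ℤ) : ℕ :=
  Mtil (quarterRows (N + k) (2 * k) 0 \ upRow 0 A) ∅

/-- The factor contributed by a pair of dents to the square of a tiling number. -/
def dentFactor (p q : ℤ) : ℚ := if p = q then 1 else |(p * (p + 1) : ℚ) - q * (q + 1)|

/-- The product of all the pairwise factors of a set of dents. -/
def dentProd (A : Finset ℤ) : ℚ := ∏ p ∈ A, ∏ q ∈ A, dentFactor p q

theorem quarterCount_eq_zero {k N : ℕ} {A : Finset ℤ}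
    (hA : A ⊆ upPositions (N + k) (2 * k) 0) (hc : A.card ≠ k) : quarterCount k N A = 0 := by
  have := tilingsCountedBy_quarterRows N k k le_rfl
  rw [Nat.sub_self, Nat.mul_zero] at this
  exact (this A hA).1 hc

theorem quarterCount_sq {k N : ℕ} {A : Finset ℤ}
    (hA : A ⊆ upPositions (N + k) (2 * k) 0) (hc : A.card = k) :
    (quarterCount k N A : ℚ) ^ 2 =
      (∏ c : Fin k, ((2 * c : ℕ).factorial : ℚ)⁻¹) ^ 2 * dentProd A := by
  have := tilingsCountedBy_quarterRows N k k le_rfl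
  rw [Nat.sub_self, Nat.mul_zero] at this
  have himage : Finset.univ.image (A.orderEmbOfFin hc) = A := by
    rw [← Finset.coe_inj, Finset.coe_image, Finset.coe_univ, Set.image_univ,
      Finset.range_orderEmbOfFin]
  have h := (this A hA).2 (A.orderEmbOfFin hc) (A.orderEmbOfFin hc).strictMono himage
  rw [evenDet_eq_prod] at h
  rw [quarterCount, show (0 : ℤ) = ((0 : ℕ) : ℤ) from rfl, h, mul_pow]
  congr 1
  generalize A.orderEmbOfFin hc = a at himage
  have hinj : Set.InjOn a (Finset.univ : Finset (Fin k)) := a.injective.injOn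
  rw [← himage, dentProd, Finset.prod_image hinj]
  simp only [Finset.prod_image hinj]
  rw [← Finset.prod_pow]
  simp only [← Finset.prod_pow]
  have h2 : ∀ i : Fin k, ∏ j, dentFactor (a i) (a j) = ∏ j ∈ {i}ᶜ, dentFactor (a i) (a j) := by
    intro i
    refine (Finset.prod_subset (Finset.subset_univ _) fun j _ hj => ?_).symm
    have : j = i := by simpa using hj
    rw [this, dentFactor, if_pos rfl]
  simp only [h2]
  rw [← Finset.prod_prod_Ioi_mul_eq_prod_prod_off_diag]
  refine Finset.prod_congr rfl fun i _ => Finset.prod_congr rfl fun j hj => ?_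
  have hij : a i ≠ a j := a.injective.ne (Finset.mem_Ioi.1 hj).ne
  rw [dentFactor, dentFactor, if_neg hij, if_neg hij.symm, abs_sub_comm, ← pow_two, sq_abs]
  push_cast
  simp

theorem dentProd_union {A S : Finset ℤ} (h : Disjoint A S) :
    dentProd (A ∪ S) = dentProd A * dentProd S *
      ∏ p ∈ A, ∏ q ∈ S, (dentFactor p q * dentFactor q p) := by
  simp only [dentProd, Finset.prod_union h, Finset.prod_mul_distrib]
  rw [Finset.prod_comm (s := S) (t := A)]
  ring

theorem prod_mul_prod_eq_of_union_inter {U D U' D' : Finset ℤ} (hcup : U ∪ D = U' ∪ D')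
    (hcap : U ∩ D = U' ∩ D') (f : ℤ → ℚ) :
    (∏ p ∈ U, f p) * ∏ p ∈ D, f p = (∏ p ∈ U', f p) * ∏ p ∈ D', f p := by
  rw [← Finset.prod_union_inter, hcup, hcap, Finset.prod_union_inter]

theorem dentProd_cross {U D U' D' S S' : Finset ℤ} (hcup : U ∪ D = U' ∪ D')
    (hcap : U ∩ D = U' ∩ D') (hS : Disjoint (U ∪ D) S) (hS' : Disjoint (U ∪ D) S') :
    dentProd (U ∪ S) * dentProd (D ∪ S) * (dentProd (U' ∪ S') * dentProd (D' ∪ S')) =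
      dentProd (U' ∪ S) * dentProd (D' ∪ S) * (dentProd (U ∪ S') * dentProd (D ∪ S')) := by
  have e := prod_mul_prod_eq_of_union_inter hcup hcap
    fun p => ∏ q ∈ S, (dentFactor p q * dentFactor q p)
  have e' := prod_mul_prod_eq_of_union_inter hcup hcap
    fun p => ∏ q ∈ S', (dentFactor p q * dentFactor q p)
  have h := hS
  have h' := hS'
  rw [hcup] at h h'
  rw [Finset.disjoint_union_left] at h h' hS hS'
  rw [dentProd_union hS.1, dentProd_union hS.2, dentProd_union hS'.1, dentProd_union hS'.2,
    dentProd_union h.1, dentProd_union h.2, dentProd_union h'.1, dentProd_union h'.2]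
  linear_combination (dentProd U * dentProd D * dentProd U' * dentProd D' *
    dentProd S ^ 2 * dentProd S' ^ 2) *
    ((∏ p ∈ U', ∏ q ∈ S', (dentFactor p q * dentFactor q p)) *
      (∏ p ∈ D', ∏ q ∈ S', (dentFactor p q * dentFactor q p)) * e -
    (∏ p ∈ U', ∏ q ∈ S, (dentFactor p q * dentFactor q p)) *
      (∏ p ∈ D', ∏ q ∈ S, (dentFactor p q * dentFactor q p)) * e')

theorem quarterCount_cross {k l k' l' N M N' M' : ℕ} {U D U' D' S S' : Finset ℤ}
    (hcu : U.card = U'.card) (hcd : D.card = D'.card)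
    (hcup : U ∪ D = U' ∪ D') (hcap : U ∩ D = U' ∩ D')
    (hS : Disjoint (U ∪ D) S) (hS' : Disjoint (U ∪ D) S')
    (hU : U ∪ U' ∪ S ⊆ upPositions (N + k) (2 * k) 0)
    (hD : D ∪ D' ∪ S ⊆ upPositions (M + l) (2 * l) 0)
    (hU' : U ∪ U' ∪ S' ⊆ upPositions (N' + k') (2 * k') 0)
    (hD' : D ∪ D' ∪ S' ⊆ upPositions (M' + l') (2 * l') 0) :
    quarterCount k N (U ∪ S) * quarterCount l M (D ∪ S) *
        (quarterCount k' N' (U' ∪ S') * quarterCount l' M' (D' ∪ S')) =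
      quarterCount k N (U' ∪ S) * quarterCount l M (D' ∪ S) *
        (quarterCount k' N' (U ∪ S') * quarterCount l' M' (D ∪ S')) := by
  have hcross := dentProd_cross hcup hcap hS hS'
  have h := hS
  have h' := hS'
  rw [hcup] at h h'
  rw [Finset.disjoint_union_left] at h h' hS hS'
  rw [Finset.union_subset_iff, Finset.union_subset_iff] at hU hD hU' hD'
  have a1 := Finset.union_subset hU.1.1 hU.2
  have a2 := Finset.union_subset hU.1.2 hU.2
  have a3 := Finset.union_subset hD.1.1 hD.2
  have a4 := Finset.union_subset hD.1.2 hD.2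
  have a5 := Finset.union_subset hU'.1.1 hU'.2
  have a6 := Finset.union_subset hU'.1.2 hU'.2
  have a7 := Finset.union_subset hD'.1.1 hD'.2
  have a8 := Finset.union_subset hD'.1.2 hD'.2
  have c1 : (U' ∪ S).card = (U ∪ S).card := by
    rw [Finset.card_union_of_disjoint h.1, Finset.card_union_of_disjoint hS.1, hcu]
  have c2 : (D' ∪ S).card = (D ∪ S).card := by
    rw [Finset.card_union_of_disjoint h.2, Finset.card_union_of_disjoint hS.2, hcd]
  have c3 : (U ∪ S').card = (U' ∪ S').card := by
    rw [Finset.card_union_of_disjoint h'.1, Finset.card_union_of_disjoint hS'.1, hcu]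
  have c4 : (D ∪ S').card = (D' ∪ S').card := by
    rw [Finset.card_union_of_disjoint h'.2, Finset.card_union_of_disjoint hS'.2, hcd]
  by_cases e1 : (U ∪ S).card = k
  swap
  · rw [quarterCount_eq_zero a1 e1, quarterCount_eq_zero a2 (by rwa [c1])]
    simp
  by_cases e2 : (D ∪ S).card = l
  swap
  · rw [quarterCount_eq_zero a3 e2, quarterCount_eq_zero a4 (by rwa [c2])]
    simp
  by_cases e3 : (U' ∪ S').card = k'
  swap
  · rw [quarterCount_eq_zero a6 e3, quarterCount_eq_zero a5 (by rwa [c3])]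
    simp
  by_cases e4 : (D' ∪ S').card = l'
  swap
  · rw [quarterCount_eq_zero a8 e4, quarterCount_eq_zero a7 (by rwa [c4])]
    simp
  rw [← pow_left_inj₀ (Nat.zero_le _) (Nat.zero_le _) two_ne_zero, ← Nat.cast_inj (R := ℚ)]
  push_cast
  simp only [mul_pow]
  rw [quarterCount_sq a1 e1, quarterCount_sq a2 (c1.trans e1), quarterCount_sq a3 e2,
    quarterCount_sq a4 (c2.trans e2), quarterCount_sq a5 (c3.trans e3), quarterCount_sq a6 e3,
    quarterCount_sq a7 (c4.trans e4), quarterCount_sq a8 e4]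
  linear_combination ((∏ c : Fin k, ((2 * c : ℕ).factorial : ℚ)⁻¹) ^ 2 *
    (∏ c : Fin l, ((2 * c : ℕ).factorial : ℚ)⁻¹) ^ 2 *
    (∏ c : Fin k', ((2 * c : ℕ).factorial : ℚ)⁻¹) ^ 2 *
    (∏ c : Fin l', ((2 * c : ℕ).factorial : ℚ)⁻¹) ^ 2) * hcross

/-- The position on the line `l`, counted from `0`, of a `1`-indexed position. -/
def shiftPos (A : Finset ℕ) : Finset ℤ := A.image fun (i : ℕ) => (i : ℤ) - 1

theorem mem_shiftPos {A : Finset ℕ} {i : ℤ} : i ∈ shiftPos A ↔ ∃ a ∈ A, (a : ℤ) - 1 = i := by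
  simp [shiftPos]

theorem shiftPos_injective : Function.Injective fun i : ℕ => (i : ℤ) - 1 := fun i j h => by
  simpa using h

theorem shiftPos_union (A B : Finset ℕ) : shiftPos (A ∪ B) = shiftPos A ∪ shiftPos B :=
  Finset.image_union _ _

theorem shiftPos_inter (A B : Finset ℕ) : shiftPos (A ∩ B) = shiftPos A ∩ shiftPos B :=
  Finset.image_inter _ _ shiftPos_injective

theorem card_shiftPos (A : Finset ℕ) : (shiftPos A).card = A.card :=
  Finset.card_image_of_injective _ shiftPos_injective

theorem upDents_eq (A : Finset ℕ) : upDents A = upRow 0 (shiftPos A) := by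
  rw [upDents, upRow, shiftPos, Finset.image_image]
  rfl

theorem barrierLoz_eq (B : Finset ℕ) : barrierLoz B = (shiftPos B).image (crossLoz 0) := by
  rw [barrierLoz, shiftPos, Finset.image_image]
  rfl

theorem image_reflTri_upRow (S : Finset ℤ) : (upRow 0 S).image reflTri = dnRow (-1) S := by
  rw [upRow, dnRow, Finset.image_image]
  refine Finset.image_congr fun i _ => ?_
  simp [reflTri, upT, dnT]

/-- The positions where a lozenge of the halved hexagon may cross the line `l`. -/
noncomputable def cutPositions (k N l M : ℕ) (P : Finset ℤ) : Finset ℤ :=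
  (upPositions (N + k) (2 * k) 0 ∩ upPositions (M + l) (2 * l) 0) \ P

theorem upT_mem_quarterRows_iff {W a : ℤ} {m : ℕ} :
    upT a 0 ∈ quarterRows W m 0 ↔ a ∈ upPositions W m 0 := by
  rw [upT, upT_mem_quarterRows, upPositions]
  split_ifs with h
  · simp [h]
  · simp only [Finset.notMem_empty, iff_false]
    omega

theorem sdiff_upRow_sdiff_upRow (R : Finset Tri) (h : ℤ) (A S : Finset ℤ) :
    (R \ upRow h A) \ upRow h S = R \ upRow h (A ∪ S) := by
  rw [upRow, upRow, upRow, Finset.image_union]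
  exact sdiff_sdiff_left

/-- Cutting a halved hexagon along the line `l` into two quartered hexagons. -/
theorem Mtil_Freg (x y n : ℕ) (U D B : Finset ℕ) :
    Mtil (Freg x y n U D) (barrierLoz B) =
      ∑ S ∈ (cutPositions (y + U.card) (x + n - U.card) (y + D.card) (x + n - D.card)
          (shiftPos (U ∪ D ∪ B))).powerset,
        quarterCount (y + U.card) (x + n - U.card) (shiftPos U ∪ S) *
          quarterCount (y + D.card) (x + n - D.card) (shiftPos D ∪ S) := by
  rw [Freg, ← Nat.mul_add, ← Nat.mul_add, Lreg_eq, Lreg_eq, barrierLoz_eq, upDents_eq, upDents_eq]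
  generalize y + U.card = k
  generalize y + D.card = l
  generalize x + n - U.card = N
  generalize x + n - D.card = M
  have low : ∀ (W : ℤ) (m : ℕ), ∀ t ∈ quarterRows W m 0, 0 ≤ t.2.2 := by
    rintro W m ⟨_ | _, a, b⟩ ht
    · exact_mod_cast (dnT_mem_quarterRows.1 ht).1
    · exact_mod_cast (upT_mem_quarterRows.1 ht).1
  have hup : ∀ t ∈ quarterRows (N + k) (2 * k) 0 \ upRow 0 (shiftPos U), 0 ≤ t.2.2 :=
    fun t ht => low _ _ t (Finset.mem_sdiff.1 ht).1
  have hdn : ∀ t ∈ (quarterRows (M + l) (2 * l) 0 \ upRow 0 (shiftPos D)).image reflTri,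
      t.2.2 < 0 := by
    intro t' ht'
    obtain ⟨t, ht, rfl⟩ := Finset.mem_image.1 ht'
    have := low _ _ t (Finset.mem_sdiff.1 ht).1
    rcases t with ⟨_ | _, a, b⟩ <;> simp [reflTri] at this ⊢ <;> omega
  rw [Mtil_union_eq_sum (h := 0) (X := cutPositions k N l M (shiftPos (U ∪ D ∪ B))) hup hdn]
  · refine Finset.sum_congr rfl fun S _ => ?_
    rw [Mtil_eq_of_forall_notMem (F := (shiftPos B).image (crossLoz 0)),
      Mtil_eq_of_forall_notMem (F := (shiftPos B).image (crossLoz 0)), zero_sub,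
      ← image_reflTri_upRow, ← Finset.image_sdiff _ _ reflTri_involutive.injective,
      Mtil_image_reflTri, sdiff_upRow_sdiff_upRow, sdiff_upRow_sdiff_upRow]
    · rfl
    · intro l hl h1
      obtain ⟨i, -, rfl⟩ := Finset.mem_image.1 hl
      have := hdn _ (Finset.mem_sdiff.1 h1).1
      simp [crossLoz, upT] at this
    · intro l hl _ h2
      obtain ⟨i, -, rfl⟩ := Finset.mem_image.1 hl
      have := hup _ (Finset.mem_sdiff.1 h2).1
      simp [crossLoz, dnT] at this
  · intro i
    have h1 : dnT i (0 - 1) = reflTri (upT i 0) := by simp [reflTri, upT, dnT]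
    have h2 : crossLoz 0 i ∈ (shiftPos B).image (crossLoz 0) ↔ i ∈ shiftPos B := by
      rw [crossLoz, mem_image_crossLoz]
      simp
    rw [h1, h2, reflTri_mem_image, Finset.mem_sdiff, Finset.mem_sdiff, upT_mem_quarterRows_iff,
      upT_mem_quarterRows_iff, upT, upT_mem_upRow, upT_mem_upRow, cutPositions, Finset.mem_sdiff,
      Finset.mem_inter, shiftPos_union, shiftPos_union, Finset.mem_union, Finset.mem_union]
    tauto

theorem shiftPos_subset_upPositions {x y n : ℕ} {U V : Finset ℕ}
    (hV : V ⊆ Finset.Icc 1 (x + y + n)) (hc : U.card = V.card) :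
    shiftPos V ⊆ upPositions ((x + n - U.card : ℕ) + (y + U.card : ℕ)) (2 * (y + U.card)) 0 := by
  intro i hi
  obtain ⟨a, ha, rfl⟩ := mem_shiftPos.1 hi
  have h1 := Finset.mem_Icc.1 (hV ha)
  have h2 := Finset.card_pos.2 ⟨a, ha⟩
  rw [upPositions, if_pos (by omega), Finset.mem_Ico]
  constructor
  · simp
    omega
  · push_cast
    omega

theorem disjoint_of_subset_cutPositions {k N l M : ℕ} {U D B : Finset ℕ} {S : Finset ℤ}
    (hS : S ⊆ cutPositions k N l M (shiftPos (U ∪ D ∪ B))) :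
    Disjoint (shiftPos U ∪ shiftPos D) S := by
  rw [← shiftPos_union, Finset.disjoint_right]
  intro i hi h
  refine (Finset.mem_sdiff.1 (hS hi)).2 ?_
  rw [shiftPos_union (U ∪ D)]
  exact Finset.mem_union_left _ h

theorem quarterCount_cross_of_subset_cutPositions
    (x y x' y' n : ℕ) (hxy : x + y = x' + y') (U D U' D' B : Finset ℕ)
    (hUsub : U ⊆ Finset.Icc 1 (x + y + n)) (hDsub : D ⊆ Finset.Icc 1 (x + y + n))
    (hU'sub : U' ⊆ Finset.Icc 1 (x + y + n)) (hD'sub : D' ⊆ Finset.Icc 1 (x + y + n))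
    (hcu : U.card = U'.card) (hcd : D.card = D'.card)
    (hcup : U ∪ D = U' ∪ D') (hcap : U ∩ D = U' ∩ D') {S S' : Finset ℤ}
    (hS : S ⊆ cutPositions (y + U.card) (x + n - U.card) (y + D.card) (x + n - D.card)
      (shiftPos (U ∪ D ∪ B)))
    (hS' : S' ⊆ cutPositions (y' + U.card) (x' + n - U.card) (y' + D.card) (x' + n - D.card)
      (shiftPos (U ∪ D ∪ B))) :
    quarterCount (y + U.card) (x + n - U.card) (shiftPos U ∪ S) *
          quarterCount (y + D.card) (x + n - D.card) (shiftPos D ∪ S) *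
        (quarterCount (y' + U.card) (x' + n - U.card) (shiftPos U' ∪ S') *
          quarterCount (y' + D.card) (x' + n - D.card) (shiftPos D' ∪ S')) =
      quarterCount (y + U.card) (x + n - U.card) (shiftPos U' ∪ S) *
          quarterCount (y + D.card) (x + n - D.card) (shiftPos D' ∪ S) *
        (quarterCount (y' + U.card) (x' + n - U.card) (shiftPos U ∪ S') *
          quarterCount (y' + D.card) (x' + n - D.card) (shiftPos D ∪ S')) := by
  have h1 := hS.trans Finset.sdiff_subset
  have h2 := hS'.trans Finset.sdiff_subset
  rw [Finset.subset_inter_iff] at h1 h2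
  refine quarterCount_cross (by simpa only [card_shiftPos]) (by simpa only [card_shiftPos])
    (by rw [← shiftPos_union, hcup, shiftPos_union])
    (by rw [← shiftPos_inter, hcap, shiftPos_inter])
    (disjoint_of_subset_cutPositions hS) (disjoint_of_subset_cutPositions hS')
    (Finset.union_subset (Finset.union_subset (shiftPos_subset_upPositions hUsub rfl)
      (shiftPos_subset_upPositions hU'sub hcu)) h1.1)
    (Finset.union_subset (Finset.union_subset (shiftPos_subset_upPositions hDsub rfl)
      (shiftPos_subset_upPositions hD'sub hcd)) h1.2)
    (Finset.union_subset (Finset.union_subset (shiftPos_subset_upPositions ?_ rfl)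
      (shiftPos_subset_upPositions ?_ hcu)) h2.1)
    (Finset.union_subset (Finset.union_subset (shiftPos_subset_upPositions ?_ rfl)
      (shiftPos_subset_upPositions ?_ hcd)) h2.2) <;>
  rwa [← hxy]

/-- **Identity (7.6)** from the concluding remarks. -/
theorem halved_hexagon_cross_identity
    (x y n : ℕ) (U D U' D' B : Finset ℕ)
    (hUsub : U ⊆ Finset.Icc 1 (x + y + n)) (hDsub : D ⊆ Finset.Icc 1 (x + y + n))
    (hU'sub : U' ⊆ Finset.Icc 1 (x + y + n)) (hD'sub : D' ⊆ Finset.Icc 1 (x + y + n))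
    (hcu : U.card = U'.card) (hcd : D.card = D'.card)
    (hcup : U ∪ D = U' ∪ D') (hcap : U ∩ D = U' ∩ D')
    (hBsub : B ⊆ Finset.Icc 1 (x + y + n) \ (U ∪ D)) (hBc : B.card ≤ x) :
    Mtil (Freg x y n U D) (barrierLoz B) *
        Mtil (Freg (x + y) 0 n U' D') (barrierLoz B) =
      Mtil (Freg x y n U' D') (barrierLoz B) *
        Mtil (Freg (x + y) 0 n U D) (barrierLoz B) := by
  rw [Mtil_Freg, Mtil_Freg, Mtil_Freg, Mtil_Freg, ← hcu, ← hcd, ← hcup, Finset.sum_mul_sum,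
    Finset.sum_mul_sum]
  refine Finset.sum_congr rfl fun S hS => Finset.sum_congr rfl fun S' hS' => ?_
  rw [Finset.mem_powerset] at hS hS'
  exact quarterCount_cross_of_subset_cutPositions x y (x + y) 0 n rfl U D U' D' B
    hUsub hDsub hU'sub hD'sub hcu hcd hcup hcap hS hS'
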